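/- arXiv:1611.03129 — 2 statements merged into one kernel-verified Lean document; each statement's English description precedes it below -/
import Mathlib

section
/- Let n ≥ a+b, let j ≥ 1 be an integer with a ≥ b, and let F ⊆ C([n],a) and G ⊆ C([n],b) be cross-intersecting families with C(n−a+b−3, b−3) + C(n−a+b−4, b−3) ≤ |F| ≤ C(n−j, a−j). Then |F| + |G| ≤ C(n,b) + C(n−j, a−j) − C(n−j, b). -/
open Finset
open scoped FinsetFamily

/-- If `i ≤ j ≤ N - i`, then `C(N, i) ≤ C(N, j)`. -/
theorem choose_le_choose_of_add_le {N i j : ℕ} (hij : i ≤ j) (hN : i + j ≤ N) :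
    N.choose i ≤ N.choose j := by
  have hpos : 0 < (N - i).choose (j - i) := Nat.choose_pos (by omega)
  refine Nat.le_of_mul_le_mul_right ?_ hpos
  rw [← Nat.choose_mul hij, ← Nat.choose_symm hij]
  exact Nat.mul_le_mul_left _ (Nat.choose_le_choose _ (by omega))

/-- A family `G` of `b`-subsets of `X` containing `T` is at most as large as any family of
`k`-subsets of `X` that contains all `k`-sets above members of `G`, if `k + b ≤ #X + #T`. -/
theorem card_le_card_of_upward {α : Type*} [DecidableEq α] {X T : Finset α}
    {G D : Finset (Finset α)} {b k : ℕ} (hG : G ⊆ X.powersetCard b) (hGT : ∀ g ∈ G, T ⊆ g)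
    (hD : D ⊆ X.powersetCard k) (hGD : ∀ g ∈ G, ∀ d ∈ X.powersetCard k, g ⊆ d → d ∈ D)
    (hTb : #T ≤ b) (hbk : b ≤ k) (hkX : k ≤ #X) (hkb : k + b ≤ #X + #T) : #G ≤ #D := by
  have hpos : 0 < (#X - b).choose (k - b) := Nat.choose_pos (by omega)
  refine Nat.le_of_mul_le_mul_right (card_mul_le_card_mul (r := (· ⊆ ·)) ?_ ?_) hpos
  · intro g hg
    obtain ⟨hgX, hgb⟩ := mem_powersetCard.1 (hG hg)
    rw [← hgb, ← card_filter_powersetCard_subset g X k hgX (by omega)]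
    refine card_le_card fun d hd => ?_
    rw [mem_filter] at hd
    exact mem_filter.2 ⟨hGD g hg d hd.1 hd.2, hd.2⟩
  · intro d hd
    obtain ⟨hdX, hdk⟩ := mem_powersetCard.1 (hD hd)
    by_cases hTd : T ⊆ d
    · calc #(G.bipartiteBelow (· ⊆ ·) d) ≤ #((d.powersetCard b).filter (T ⊆ ·)) := by
            refine card_le_card fun g hg => ?_
            obtain ⟨hgG, hgd⟩ := mem_filter.1 hg
            exact mem_filter.2
              ⟨mem_powersetCard.2 ⟨hgd, (mem_powersetCard.1 (hG hgG)).2⟩, hGT g hgG⟩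
        _ = (k - #T).choose (b - #T) := by
            rw [card_filter_powersetCard_subset T d b hTd hTb, hdk]
        _ = (k - #T).choose (k - b) := by
            rw [← Nat.choose_symm (by omega)]
            congr 1
            omega
        _ ≤ (#X - b).choose (k - b) := Nat.choose_le_choose _ (by omega)
    · have h0 : G.bipartiteBelow (· ⊆ ·) d = ∅ :=
        filter_eq_empty_iff.2 fun g hg hgd => hTd ((hGT g hg).trans hgd)
      simp [h0]

/-- Colex initial segments of every admissible size exist. -/
theorem exists_isInitSeg_card_eq {α : Type*} [LinearOrder α] [Fintype α] (r : ℕ) {m : ℕ}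
    (hm : m ≤ (Fintype.card α).choose r) :
    ∃ 𝒞 : Finset (Finset α), Colex.IsInitSeg 𝒞 r ∧ #𝒞 = m := by
  induction m with
  | zero => exact ⟨∅, Colex.isInitSeg_empty, rfl⟩
  | succ m ih =>
    obtain ⟨𝒞, h𝒞, hcard⟩ := ih (by omega)
    have hne : (univ.powersetCard r \ 𝒞).Nonempty := by
      rw [← card_pos]
      have := le_card_sdiff 𝒞 ((univ : Finset α).powersetCard r)
      rw [card_powersetCard, card_univ] at this
      omega
    obtain ⟨s, hs, hmin⟩ := exists_min_image _ toColex hne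
    obtain ⟨hsr, hs𝒞⟩ := mem_sdiff.1 hs
    have hsr := (mem_powersetCard.1 hsr).2
    refine ⟨insert s 𝒞, ⟨?_, ?_⟩, by rw [card_insert_of_notMem hs𝒞, hcard]⟩
    · intro u hu
      rcases mem_insert.1 (mem_coe.1 hu) with rfl | hu
      exacts [hsr, h𝒞.1 hu]
    · rintro u v hu ⟨hvu, hvr⟩
      rcases mem_insert.1 hu with rfl | hu
      · by_contra hv
        refine absurd (hmin v (mem_sdiff.2 ⟨mem_powersetCard.2 ⟨subset_univ _, hvr⟩, ?_⟩))
          (not_le.2 hvu)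
        exact fun h => hv (mem_insert_of_mem h)
      · exact mem_insert_of_mem (h𝒞.2 hu ⟨hvu, hvr⟩)

section Initial

variable {n : ℕ}

/-- The first `N` elements of `Fin n`. -/
def finBelow (n N : ℕ) : Finset (Fin n) := {i | i.val < N}

/-- The last `t` among the first `N` elements of `Fin n`. -/
def finTop (n N t : ℕ) : Finset (Fin n) := {i | N - t ≤ i.val ∧ i.val < N}

theorem card_finBelow {N : ℕ} (hN : N ≤ n) : #(finBelow n N) = N := by
  exact Fin.card_filter_val_lt.trans (min_eq_right hN)

theorem finTop_subset (N t : ℕ) : finTop n N t ⊆ finBelow n N := fun i hi => by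
  simp_all [finTop, finBelow]

theorem card_finTop {N t : ℕ} (hN : N ≤ n) (ht : t ≤ N) : #(finTop n N t) = t := by
  have h : finTop n N t = finBelow n N \ finBelow n (N - t) := by
    ext i
    simp [finTop, finBelow]
    omega
  rw [h, card_sdiff_of_subset, card_finBelow hN, card_finBelow (by omega)]
  · omega
  · intro i
    simp [finBelow]
    omega

theorem isInitSeg_powersetCard_finBelow (N k : ℕ) :
    Colex.IsInitSeg ((finBelow n N).powersetCard k) k := by
  refine ⟨fun s hs => (mem_powersetCard.1 hs).2, ?_⟩
  rintro s u hs ⟨hus, hu⟩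
  obtain ⟨x, hxs, hxu, hx⟩ := Colex.toColex_lt_toColex_iff_exists_forall_lt.1 hus
  have hsX := (mem_powersetCard.1 hs).1
  refine mem_powersetCard.2 ⟨fun i hi => ?_, hu⟩
  by_cases his : i ∈ s
  · exact hsX his
  · have h1 := hx i hi his
    have h2 := hsX hxs
    simp only [finBelow, mem_filter_univ] at h2 ⊢
    exact lt_trans h1 h2

theorem isInitSeg_filter_not_finTop_subset (N k t : ℕ) :
    Colex.IsInitSeg {s ∈ (finBelow n N).powersetCard k | ¬ finTop n N t ⊆ s} k := by
  refine ⟨fun s hs => (mem_powersetCard.1 (mem_filter.1 hs).1).2, ?_⟩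
  rintro s u hs ⟨hus, hu⟩
  obtain ⟨hs, hsT⟩ := mem_filter.1 hs
  refine mem_filter.2 ⟨(isInitSeg_powersetCard_finBelow N k).2 hs ⟨hus, hu⟩, fun hT => ?_⟩
  obtain ⟨x, hxs, hxu, hx⟩ := Colex.toColex_lt_toColex_iff_exists_forall_lt.1 hus
  obtain ⟨y, hyT, hys⟩ := not_subset.1 hsT
  have h1 := hx y (hT hyT) hys
  have h2 := (mem_powersetCard.1 hs).1 hxs
  refine hxu (hT ?_)
  simp only [finBelow, finTop, mem_filter_univ] at h2 hyT ⊢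
  exact ⟨hyT.1.trans h1.le, h2⟩

theorem subset_of_isInitSeg_of_card_le {𝒜 ℬ : Finset (Finset (Fin n))} {r : ℕ}
    (h𝒜 : Colex.IsInitSeg 𝒜 r) (hℬ : Colex.IsInitSeg ℬ r) (h : #𝒜 ≤ #ℬ) : 𝒜 ⊆ ℬ := by
  rcases h𝒜.total hℬ with h' | h'
  · exact h'
  · exact (eq_of_subset_of_card_le h' h).ge

/-- A lower bound on iterated shadows of families whose size lies between that of the `k`-sets in
`[N]` not containing the top `t` elements, and that of all `k`-sets in `[N]`. -/
theorem choose_add_card_le_of_finTop {𝒜 : Finset (Finset (Fin n))} {N b k t : ℕ}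
    (h𝒜 : (𝒜 : Set (Finset (Fin n))).Sized k) (hN : N ≤ n) (htb : t ≤ b) (hbk : b ≤ k)
    (hkN : k + 1 ≤ N) (hkb : k + b ≤ N + t)
    (hlow : N.choose k ≤ #𝒜 + (N - t).choose (k - t)) (hhigh : #𝒜 ≤ N.choose k) :
    N.choose b + #𝒜 ≤ N.choose k + #(∂^[k - b] 𝒜) := by
  set X := finBelow n N
  set T := finTop n N t
  have hXc : #X = N := card_finBelow hN
  have hTc : #T = t := card_finTop hN (by omega)
  have hTX : T ⊆ X := finTop_subset N t
  obtain ⟨𝒞, h𝒞, hcard⟩ := exists_isInitSeg_card_eq (α := Fin n) k (m := #𝒜)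
    (by simpa using hhigh.trans (Nat.choose_le_choose k hN))
  have hkk : #(∂^[k - b] 𝒞) ≤ #(∂^[k - b] 𝒜) := iterated_kk h𝒜 hcard.le h𝒞
  have h𝒞X : 𝒞 ⊆ X.powersetCard k :=
    subset_of_isInitSeg_of_card_le h𝒞 (isInitSeg_powersetCard_finBelow N k)
      (by rw [hcard, card_powersetCard, hXc]; exact hhigh)
  have hE𝒞 : {s ∈ X.powersetCard k | ¬ T ⊆ s} ⊆ 𝒞 := by
    refine subset_of_isInitSeg_of_card_le (isInitSeg_filter_not_finTop_subset N k t) h𝒞 ?_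
    have h1 := card_filter_add_card_filter_not (s := X.powersetCard k) (T ⊆ ·)
    rw [card_filter_powersetCard_subset T X k hTX (by omega), card_powersetCard, hXc, hTc] at h1
    omega
  have key : #(X.powersetCard b \ ∂^[k - b] 𝒞) ≤ #(X.powersetCard k \ 𝒞) := by
    refine card_le_card_of_upward (X := X) (T := T) (b := b) (k := k) sdiff_subset ?_
      sdiff_subset ?_ (by omega) hbk (by omega) (by omega)
    · intro g hg
      obtain ⟨hgX, hg𝒞⟩ := mem_sdiff.1 hg
      obtain ⟨hgX, hgb⟩ := mem_powersetCard.1 hgX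
      by_contra hTg
      obtain ⟨x, hxT, hxg⟩ := not_subset.1 hTg
      obtain ⟨s, hgs, hsX, hsk⟩ := exists_subsuperset_card_eq (s := g) (t := X.erase x) (n := k)
        (subset_erase.2 ⟨hgX, hxg⟩) (by omega)
        (by rw [card_erase_of_mem (hTX hxT)]; omega)
      obtain ⟨hsX, hxs⟩ := subset_erase.1 hsX
      refine hg𝒞 (mem_shadow_iterate_iff_exists_mem_card_add.2 ⟨s, hE𝒞 ?_, hgs, by omega⟩)
      exact mem_filter.2 ⟨mem_powersetCard.2 ⟨hsX, hsk⟩, fun h => hxs (h hxT)⟩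
    · intro g hg d hd hgd
      obtain ⟨hgX, hg𝒞⟩ := mem_sdiff.1 hg
      refine mem_sdiff.2 ⟨hd, fun hd𝒞 => hg𝒞 ?_⟩
      refine mem_shadow_iterate_iff_exists_mem_card_add.2 ⟨d, hd𝒞, hgd, ?_⟩
      have := (mem_powersetCard.1 hgX).2
      have := (mem_powersetCard.1 hd).2
      omega
  have h1 := le_card_sdiff (∂^[k - b] 𝒞) (X.powersetCard b)
  rw [card_sdiff_of_subset h𝒞X] at key
  rw [card_powersetCard, hXc] at h1 key
  omega

/-- The iterated shadow of a sufficiently large family of `k`-sets, of size at most `C(N, k)`,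
exceeds the family by at least as much as for the family of all `k`-subsets of `[N]`. -/
theorem choose_add_card_le_choose_add_card_shadow {𝒜 : Finset (Finset (Fin n))} {N b k : ℕ}
    (h𝒜 : (𝒜 : Set (Finset (Fin n))).Sized k) (hN : N ≤ n) (hb : 1 ≤ b) (hbk : b ≤ k)
    (hlow : (k + b - 3).choose (b - 3) + (k + b - 4).choose (b - 3) ≤ #𝒜)
    (hhigh : #𝒜 ≤ N.choose k) :
    N.choose b + #𝒜 ≤ N.choose k + #(∂^[k - b] 𝒜) := by
  have htwo : 2 ≤ #𝒜 := by
    have h1 : 0 < (k + b - 3).choose (b - 3) := Nat.choose_pos (by omega)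
    have h2 : 0 < (k + b - 4).choose (b - 3) := Nat.choose_pos (by omega)
    omega
  obtain ⟨k, rfl⟩ : ∃ k', k = k' + 1 := ⟨k - 1, by omega⟩
  obtain ⟨b, rfl⟩ : ∃ b', b = b' + 1 := ⟨b - 1, by omega⟩
  induction N with
  | zero =>
    rw [Nat.choose_zero_succ] at hhigh
    omega
  | succ N ih =>
    have hkN : k + 1 ≤ N := by
      by_contra! h
      have := hhigh.trans (Nat.choose_le_choose (k + 1) (show N + 1 ≤ k + 1 by omega))
      rw [Nat.choose_self] at this
      omega
    by_cases h : #𝒜 ≤ N.choose (k + 1)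
    · have hIH := ih (by omega) h
      have hkbN : b + k ≤ N := by
        by_contra! h'
        have h3 := h.trans (Nat.choose_le_choose (k + 1) (show N ≤ k + 1 + (b + 1) - 3 by omega))
        have h4 : (k + 1 + (b + 1) - 3).choose (b + 1 - 3) =
            (k + 1 + (b + 1) - 3).choose (k + 1) := Nat.choose_symm_of_eq_add (by omega)
        have h5 : 0 < (k + 1 + (b + 1) - 4).choose (b + 1 - 3) := Nat.choose_pos (by omega)
        omega
      have := choose_le_choose_of_add_le (N := N) (i := b) (j := k) (by omega) hkbN
      rw [Nat.choose_succ_succ N b, Nat.choose_succ_succ N k]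
      simp only [Nat.succ_eq_add_one]
      omega
    · by_cases hkbN : k + b ≤ N
      · refine choose_add_card_le_of_finTop (t := 1) h𝒜 hN (by omega) hbk (by omega) (by omega)
          ?_ hhigh
        rw [Nat.choose_succ_succ N k]
        simp only [Nat.succ_eq_add_one, Nat.add_sub_cancel]
        omega
      · have hkbN' : N + 1 = k + b := by
          by_contra h'
          have h3 := hhigh.trans (Nat.choose_le_choose (k + 1)
            (show N + 1 ≤ k + 1 + (b + 1) - 3 by omega))
          have h4 : (k + 1 + (b + 1) - 3).choose (b + 1 - 3) =
              (k + 1 + (b + 1) - 3).choose (k + 1) := Nat.choose_symm_of_eq_add (by omega)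
          have h5 : 0 < (k + 1 + (b + 1) - 4).choose (b + 1 - 3) := Nat.choose_pos (by omega)
          omega
        refine choose_add_card_le_of_finTop (t := 2) h𝒜 hN (by omega) hbk (by omega) (by omega)
          ?_ hhigh
        obtain ⟨M, rfl⟩ : ∃ M, N = M + 1 := ⟨N - 1, by omega⟩
        obtain ⟨l, rfl⟩ : ∃ l, k = l + 1 := ⟨k - 1, by omega⟩
        have e1 : l + 1 + 1 + (b + 1) - 3 = M + 1 := by omega
        have e2 : l + 1 + 1 + (b + 1) - 4 = M := by omega
        rw [e1, e2, Nat.choose_symm_of_eq_add (show M + 1 = b + 1 - 3 + (l + 2) by omega),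
          Nat.choose_symm_of_eq_add (show M = b + 1 - 3 + (l + 1) by omega)] at hlow
        rw [Nat.choose_succ_succ (M + 1) (l + 1), Nat.choose_succ_succ M l]
        simp only [Nat.succ_eq_add_one,
          show M + 1 + 1 - 2 = M by omega, show l + 1 + 1 - 2 = l by omega,
          show l + 1 + 1 = l + 2 by omega]
        omega

end Initial

/-- A set of positive integers seen in `Fin n`, where `i : Fin n` stands for `i + 1`. -/
def toFinSet (n : ℕ) (A : Finset ℕ) : Finset (Fin n) := {i | i.val + 1 ∈ A}

theorem mem_toFinSet {n : ℕ} {A : Finset ℕ} {i : Fin n} : i ∈ toFinSet n A ↔ i.val + 1 ∈ A :=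
  mem_filter_univ i

theorem map_toFinSet {n : ℕ} {A : Finset ℕ} (hA : A ⊆ Icc 1 n) :
    (toFinSet n A).map (Fin.valEmbedding.trans (addRightEmbedding 1)) = A := by
  ext x
  simp only [mem_map, mem_toFinSet, Function.Embedding.trans_apply, Fin.valEmbedding_apply,
    addRightEmbedding_apply]
  constructor
  · rintro ⟨i, hi, rfl⟩
    exact hi
  · intro hx
    obtain ⟨h1, h2⟩ := mem_Icc.1 (hA hx)
    exact ⟨⟨x - 1, by omega⟩, by simpa [Nat.sub_add_cancel h1] using hx, by simp; omega⟩

theorem card_toFinSet {n : ℕ} {A : Finset ℕ} (hA : A ⊆ Icc 1 n) : #(toFinSet n A) = #A := by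
  conv_rhs => rw [← map_toFinSet hA, card_map]

theorem injOn_toFinSet {n a : ℕ} {F : Finset (Finset ℕ)} (hF : F ⊆ (Icc 1 n).powersetCard a) :
    Set.InjOn (toFinSet n) (F : Set (Finset ℕ)) := fun A hA B hB h => by
  rw [← map_toFinSet (mem_powersetCard.1 (hF hA)).1, h,
    map_toFinSet (mem_powersetCard.1 (hF hB)).1]

/-- For cross-intersecting families `F` and `G`, no member of `G` lies in the shadow of the
complements of `F`. -/
theorem exists_sized_card_shadow_add_card_le {n a b : ℕ} (hn : a + b ≤ n)
    {F G : Finset (Finset ℕ)} (hF : F ⊆ (Icc 1 n).powersetCard a)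
    (hG : G ⊆ (Icc 1 n).powersetCard b) (hcross : ∀ A ∈ F, ∀ B ∈ G, (A ∩ B).Nonempty) :
    ∃ 𝒜 : Finset (Finset (Fin n)), (𝒜 : Set (Finset (Fin n))).Sized (n - a) ∧ #𝒜 = #F ∧
      #(∂^[n - a - b] 𝒜) + #G ≤ n.choose b := by
  have hsized : ((F.image fun A => (toFinSet n A)ᶜ : Finset _) :
      Set (Finset (Fin n))).Sized (n - a) := by
    intro s hs
    obtain ⟨A, hA, rfl⟩ := mem_image.1 (mem_coe.1 hs)
    obtain ⟨hA1, hA2⟩ := mem_powersetCard.1 (hF hA)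
    rw [card_compl, card_toFinSet hA1, hA2, Fintype.card_fin]
  refine ⟨_, hsized, ?_, ?_⟩
  · exact card_image_of_injOn fun A hA B hB h => injOn_toFinSet hF hA hB (compl_injective h)
  · rw [← card_image_of_injOn (injOn_toFinSet hG), ← card_union_of_disjoint]
    · refine (card_le_card (t := univ.powersetCard b) fun s hs => ?_).trans
        (by rw [card_powersetCard, card_univ, Fintype.card_fin])
      refine mem_powersetCard.2 ⟨subset_univ _, ?_⟩
      rcases mem_union.1 hs with hs | hs
      · rw [hsized.shadow_iterate hs]
        omega
      · obtain ⟨B, hB, rfl⟩ := mem_image.1 hs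
        obtain ⟨hB1, hB2⟩ := mem_powersetCard.1 (hG hB)
        rw [card_toFinSet hB1, hB2]
    · rw [disjoint_left]
      intro s hs hsG
      obtain ⟨B, hB, rfl⟩ := mem_image.1 hsG
      obtain ⟨u, hu, hBu, -⟩ := mem_shadow_iterate_iff_exists_mem_card_add.1 hs
      obtain ⟨A, hA, rfl⟩ := mem_image.1 hu
      obtain ⟨x, hx⟩ := hcross A hA B hB
      obtain ⟨hxA, hxB⟩ := mem_inter.1 hx
      obtain ⟨h1, h2⟩ := mem_Icc.1 ((mem_powersetCard.1 (hG hB)).1 hxB)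
      have hmem : ∀ C : Finset ℕ, (⟨x - 1, by omega⟩ : Fin n) ∈ toFinSet n C ↔ x ∈ C := fun C => by
        rw [mem_toFinSet, Nat.sub_add_cancel h1]
      exact mem_compl.1 (hBu ((hmem B).2 hxB)) ((hmem A).2 hxA)

/-- Theorem 2, Point 3: let `n ≥ a + b`, `j ≥ 1`, `a ≥ b`, and let `F ⊆ C([n],a)`,
`G ⊆ C([n],b)` be cross-intersecting with
`C(n-a+b-3, b-3) + C(n-a+b-4, b-3) ≤ |F| ≤ C(n-j, a-j)`. Then
`|F| + |G| ≤ C(n,b) + C(n-j, a-j) - C(n-j, b)`. -/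
theorem sum_bound_point3 (n a b j : ℕ) (hj : 1 ≤ j) (hab : b ≤ a) (hn : a + b ≤ n)
    (F G : Finset (Finset ℕ))
    (hF : F ⊆ (Finset.Icc 1 n).powersetCard a)
    (hG : G ⊆ (Finset.Icc 1 n).powersetCard b)
    (hcross : ∀ A ∈ F, ∀ B ∈ G, (A ∩ B).Nonempty)
    (hFlow : (n - a + b - 3).choose (b - 3) + (n - a + b - 4).choose (b - 3) ≤ F.card)
    (hFhigh : F.card ≤ (n - j).choose (a - j)) :
    F.card + G.card ≤ n.choose b + (n - j).choose (a - j) - (n - j).choose b := by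
  have htwo : 2 ≤ #F := by
    have h1 : 0 < (n - a + b - 3).choose (b - 3) := Nat.choose_pos (by omega)
    have h2 : 0 < (n - a + b - 4).choose (b - 3) := Nat.choose_pos (by omega)
    omega
  have hja : j ≤ a := by
    by_contra! h
    rw [Nat.sub_eq_zero_of_le h.le, Nat.choose_zero_right] at hFhigh
    omega
  obtain ⟨𝒜, h𝒜, hcard, hshadow⟩ := exists_sized_card_shadow_add_card_le hn hF hG hcross
  rcases Nat.eq_zero_or_pos b with rfl | hb
  · have hG0 : G = ∅ := by
      obtain ⟨A, hA⟩ := card_pos.1 (show 0 < #F by omega)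
      refine eq_empty_of_forall_notMem fun B hB => ?_
      have hB0 := card_eq_zero.1 (mem_powersetCard.1 (hG hB)).2
      simpa [hB0] using hcross A hA B hB
    simp only [hG0, card_empty, Nat.choose_zero_right]
    omega
  · have hsymm : (n - j).choose (a - j) = (n - j).choose (n - a) :=
      Nat.choose_symm_of_eq_add (by omega)
    have hmono := Nat.choose_le_choose b (Nat.sub_le n j)
    have := choose_add_card_le_choose_add_card_shadow (N := n - j) h𝒜 (Nat.sub_le n j) hb
      (by omega) (by rwa [hcard]) (by rwa [hcard, ← hsymm])
    omega
end

section
/- Let n > 2k > 0 and let F ⊆ C([n],k) be an intersecting family. If γ(F) ≥ C(n−u−1, n−k−1) for some real number u with 3 ≤ u ≤ k, where C(x,m) denotes the generalized binomial coefficient, then |F| ≤ C(n−1, k−1) + C(n−u−1, n−k−1) − C(n−u−1, k−1). -/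
/-- The generalized binomial coefficient `C(x, m) = x(x-1)⋯(x-m+1)/m!`
for a real `x` and a natural number `m`. -/
noncomputable def genChoose (x : ℝ) (m : ℕ) : ℝ :=
  (∏ i ∈ Finset.range m, (x - i)) / (Nat.factorial m)

/-- The maximal degree `Δ(F) = max_{i ∈ [n]} |{F ∈ F : i ∈ F}|`. -/
def maxDegree (n : ℕ) (F : Finset (Finset ℕ)) : ℕ :=
  (Finset.Icc 1 n).sup (fun i => (F.filter (fun A => i ∈ A)).card)

/-- The diversity `γ(F) = |F| - Δ(F)`. -/
def diversity (n : ℕ) (F : Finset (Finset ℕ)) : ℕ :=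
  F.card - maxDegree n F

open Finset

lemma genChoose_zero (x : ℝ) : genChoose x 0 = 1 := by simp [genChoose]

lemma genChoose_succ (x : ℝ) (m : ℕ) :
    genChoose x (m + 1) = genChoose x m * ((x - m) / (m + 1)) := by
  unfold genChoose
  rw [prod_range_succ, Nat.factorial_succ]
  push_cast
  field_simp

lemma genChoose_succ_eq (x : ℝ) (m : ℕ) :
    genChoose x (m + 1) = x / (m + 1) * genChoose (x - 1) m := by
  unfold genChoose
  rw [prod_range_succ', Nat.factorial_succ]
  push_cast
  have : ∏ i ∈ range m, (x - (i + 1)) = ∏ i ∈ range m, (x - 1 - i) :=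
    prod_congr rfl fun i _ => by ring
  rw [this]
  field_simp
  ring

/-- Pascal's rule for generalized binomial coefficients. -/
lemma genChoose_pascal (x : ℝ) (m : ℕ) :
    genChoose x (m + 1) = genChoose (x - 1) (m + 1) + genChoose (x - 1) m := by
  rw [genChoose_succ_eq, genChoose_succ]
  field_simp
  ring

lemma genChoose_natCast (n m : ℕ) : genChoose n m = n.choose m := by
  induction m with
  | zero => simp [genChoose_zero]
  | succ m ih =>
    rw [genChoose_succ, ih]
    have h := Nat.choose_succ_right_eq n m
    rcases le_or_gt m n with hmn | hmn
    · have h' : ((n.choose (m + 1) : ℕ) : ℝ) * (m + 1) = n.choose m * (n - m) := by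
        rw [← Nat.cast_sub hmn]; exact_mod_cast h
      rw [← mul_div_assoc, ← h']
      field_simp
    · simp [Nat.choose_eq_zero_of_lt hmn, Nat.choose_eq_zero_of_lt (hmn.trans (Nat.lt_succ_self m))]

lemma genChoose_nonneg {x : ℝ} {m : ℕ} (hx : (m : ℝ) ≤ x + 1) : 0 ≤ genChoose x m := by
  refine div_nonneg (prod_nonneg fun i hi => ?_) (by positivity)
  have : (i : ℝ) + 1 ≤ m := by exact_mod_cast mem_range.1 hi
  linarith

lemma genChoose_pos {x : ℝ} {m : ℕ} (hx : (m : ℝ) < x + 1) : 0 < genChoose x m := by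
  refine div_pos (prod_pos fun i hi => ?_) (by positivity)
  have : (i : ℝ) + 1 ≤ m := by exact_mod_cast mem_range.1 hi
  linarith

lemma genChoose_le_genChoose {x y : ℝ} {m : ℕ} (hx : (m : ℝ) ≤ x + 1) (hxy : x ≤ y) :
    genChoose x m ≤ genChoose y m := by
  refine div_le_div_of_nonneg_right (prod_le_prod (fun i hi => ?_) fun i hi => ?_) (by positivity)
  · have : (i : ℝ) + 1 ≤ m := by exact_mod_cast mem_range.1 hi
    linarith
  · linarith

lemma continuous_genChoose (m : ℕ) : Continuous fun x => genChoose x m := by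
  unfold genChoose
  fun_prop

lemma exists_genChoose_eq {a b g : ℝ} {m : ℕ} (hab : a ≤ b) (ha : genChoose a m ≤ g)
    (hb : g ≤ genChoose b m) : ∃ x, a ≤ x ∧ x ≤ b ∧ genChoose x m = g := by
  obtain ⟨x, hx, rfl⟩ := intermediate_value_Icc hab (continuous_genChoose m).continuousOn ⟨ha, hb⟩
  exact ⟨x, hx.1, hx.2, rfl⟩

/-- The ratio `C(x, p) / C(x, q)` for `q ≤ p`. -/
noncomputable def genChooseRatio (q p : ℕ) (x : ℝ) : ℝ := ∏ i ∈ Ico q p, ((x - i) / (i + 1))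

lemma genChoose_eq_mul_ratio {q p : ℕ} (hqp : q ≤ p) (x : ℝ) :
    genChoose x p = genChoose x q * genChooseRatio q p x := by
  induction p, hqp using Nat.le_induction with
  | base => simp [genChooseRatio]
  | succ p hqp ih =>
    rw [genChoose_succ, ih, genChooseRatio, genChooseRatio, prod_Ico_succ_top hqp, mul_assoc]

lemma genChooseRatio_mono {q p : ℕ} {x y : ℝ} (hx : (p : ℝ) ≤ x + 1) (hxy : x ≤ y) :
    genChooseRatio q p x ≤ genChooseRatio q p y := by
  refine prod_le_prod (fun i hi => ?_) fun i hi => by gcongr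
  have : (i : ℝ) + 1 ≤ p := by exact_mod_cast (mem_Ico.1 hi).2
  exact div_nonneg (by linarith) (by positivity)

lemma genChooseRatio_add {q p : ℕ} (hqp : q ≤ p) : genChooseRatio q p ((p + q : ℕ) : ℝ) = 1 := by
  have h := genChoose_eq_mul_ratio hqp ((p + q : ℕ) : ℝ)
  rw [genChoose_natCast, genChoose_natCast, Nat.choose_symm_add] at h
  have : ((p + q).choose q : ℝ) ≠ 0 := by
    exact_mod_cast (Nat.choose_pos (by omega)).ne'
  exact mul_left_cancel₀ this (by rw [← h, mul_one])

lemma genChooseRatio_lt_one {q p : ℕ} (hqp : q < p) {x : ℝ} (hx : (p : ℝ) ≤ x + 1)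
    (hxs : x < p + q) : genChooseRatio q p x < 1 := by
  rw [← genChooseRatio_add hqp.le]
  rcases eq_or_lt_of_le hx with h | h
  · have h1 : genChooseRatio q p x = 0 := by
      refine prod_eq_zero (i := p - 1) (by simp; omega) ?_
      rw [Nat.cast_sub (by omega)]
      simp; left; linarith
    rw [h1, genChooseRatio_add hqp.le]
    exact one_pos
  · refine prod_lt_prod (fun i hi => ?_) (fun i hi => ?_) ⟨q, by simpa using hqp, ?_⟩
    · have : (i : ℝ) + 1 ≤ p := by exact_mod_cast (mem_Ico.1 hi).2
      exact div_pos (by linarith) (by positivity)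
    · push_cast; gcongr
    · push_cast; gcongr

lemma genChoose_le_of_le_add {q p : ℕ} (hqp : q ≤ p) {x : ℝ} (hx : (p : ℝ) ≤ x + 1)
    (hxs : x ≤ p + q) : genChoose x p ≤ genChoose x q := by
  have hq : (q : ℝ) ≤ p := by exact_mod_cast hqp
  rw [genChoose_eq_mul_ratio hqp]
  refine mul_le_of_le_one_right (genChoose_nonneg (by linarith)) ?_
  rw [← genChooseRatio_add hqp]
  exact genChooseRatio_mono hx (by push_cast; exact hxs)

lemma convexOn_genChooseRatio (q p : ℕ) : ConvexOn ℝ (Set.Ici ((p : ℝ) - 1)) (genChooseRatio q p) := by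
  have key : ∀ s : Finset ℕ, s ⊆ Ico q p →
      ConvexOn ℝ (Set.Ici ((p : ℝ) - 1)) (fun x : ℝ => ∏ i ∈ s, ((x - i) / (i + 1))) ∧
      MonotoneOn (fun x : ℝ => ∏ i ∈ s, ((x - i) / (i + 1))) (Set.Ici ((p : ℝ) - 1)) ∧
      ∀ x ∈ Set.Ici ((p : ℝ) - 1), 0 ≤ ∏ i ∈ s, ((x - i) / ((i : ℝ) + 1)) := by
    intro s
    induction s using Finset.induction_on with
    | empty =>
      intro _
      simp only [prod_empty]
      exact ⟨convexOn_const _ (convex_Ici _), monotoneOn_const, fun _ _ => zero_le_one⟩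
    | insert a s ha ih =>
      intro hs
      obtain ⟨h1, h2, h3⟩ := ih ((subset_insert _ _).trans hs)
      have hap : (a : ℝ) + 1 ≤ p := by exact_mod_cast (mem_Ico.1 (hs (mem_insert_self a s))).2
      have g1 : ConvexOn ℝ (Set.Ici ((p : ℝ) - 1)) (fun x : ℝ => (x - a) / (a + 1)) :=
        ⟨convex_Ici _, fun x _ y _ c d _ _ hcd => le_of_eq (by
          simp only [smul_eq_mul]; field_simp; linear_combination (a : ℝ) * hcd)⟩
      have g2 : MonotoneOn (fun x : ℝ => (x - a) / ((a : ℝ) + 1)) (Set.Ici ((p : ℝ) - 1)) :=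
        fun x _ y _ hxy => by dsimp; gcongr
      have g3 : ∀ x ∈ Set.Ici ((p : ℝ) - 1), 0 ≤ (x - a) / ((a : ℝ) + 1) := fun x hx =>
        div_nonneg (by have := Set.mem_Ici.1 hx; linarith) (by positivity)
      simp only [prod_insert ha]
      refine ⟨g1.mul h1 (fun x hx => g3 x hx) (fun x hx => h3 x hx) (g2.monovaryOn h2),
        fun x hx y hy hxy => mul_le_mul (g2 hx hy hxy) (h2 hx hy hxy) (h3 x hx) (g3 y hy),
        fun x hx => mul_nonneg (g3 x hx) (h3 x hx)⟩
  exact (key _ subset_rfl).1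

lemma concaveOn_log_genChoose (q : ℕ) :
    ConcaveOn ℝ (Set.Ioi ((q : ℝ) - 1)) fun x => Real.log (genChoose x q) := by
  have h : ConcaveOn ℝ (Set.Ioi ((q : ℝ) - 1))
      (fun x : ℝ => ∑ i ∈ range q, Real.log (x - i) - Real.log (Nat.factorial q)) := by
    refine ⟨convex_Ioi _, fun x hx y hy a b ha hb hab => ?_⟩
    have hs : ∀ i ∈ range q, a * Real.log (x - i) + b * Real.log (y - i) ≤
        Real.log (a * x + b * y - i) := by
      intro i hi
      have hiq : (i : ℝ) + 1 ≤ q := by exact_mod_cast mem_range.1 hi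
      have := strictConcaveOn_log_Ioi.concaveOn.2 (x := x - i) (y := y - i)
        (by simp at hx ⊢; linarith) (by simp at hy ⊢; linarith) ha hb hab
      simp only [smul_eq_mul] at this
      have e : a * (x - i) + b * (y - i) = a * x + b * y - i := by
        linear_combination -(i : ℝ) * hab
      rwa [e] at this
    have := sum_le_sum hs
    rw [sum_add_distrib, ← mul_sum, ← mul_sum] at this
    simp only [smul_eq_mul]
    have e : Real.log (q.factorial : ℝ) = a * Real.log (q.factorial : ℝ) + b * Real.log (q.factorial : ℝ) := by
      rw [← add_mul, hab, one_mul]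
    linarith
  refine h.congr fun x hx => ?_
  have hx' : (q : ℝ) - 1 < x := hx
  have hne : ∀ i ∈ range q, x - (i : ℝ) ≠ 0 := fun i hi => by
    have hiq : (i : ℝ) + 1 ≤ q := by exact_mod_cast mem_range.1 hi
    linarith
  dsimp only
  rw [genChoose, Real.log_div (prod_ne_zero_iff.2 hne) (by positivity), Real.log_prod hne]

lemma genChoose_sub_pos {q p : ℕ} (hqp : q < p) {x : ℝ} (hx : (p : ℝ) ≤ x + 1)
    (hxs : x < p + q) : 0 < genChoose x q - genChoose x p := by
  have hq : (q : ℝ) + 1 ≤ p := by exact_mod_cast hqp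
  rw [genChoose_eq_mul_ratio hqp.le, ← mul_one_sub]
  exact mul_pos (genChoose_pos (by linarith)) (by linarith [genChooseRatio_lt_one hqp hx hxs])

lemma concaveOn_log_genChoose_sub {q p : ℕ} (hqp : q < p) :
    ConcaveOn ℝ (Set.Ico (p : ℝ) (p + q)) fun x => Real.log (genChoose x q - genChoose x p) := by
  have hq : (q : ℝ) + 1 ≤ p := by exact_mod_cast hqp
  have h1 := (concaveOn_log_genChoose q).subset (s := Set.Ico (p : ℝ) (p + q))
    (fun x hx => by simp at hx ⊢; linarith) (convex_Ico _ _)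
  have h2 : ConcaveOn ℝ (Set.Ico (p : ℝ) (p + q)) fun x => Real.log (1 - genChooseRatio q p x) := by
    refine ⟨convex_Ico _ _, fun x hx y hy a b ha hb hab => ?_⟩
    have hr := (convexOn_genChooseRatio q p).2 (x := x) (y := y) (by simp at hx ⊢; linarith)
      (by simp at hy ⊢; linarith) ha hb hab
    have px := genChooseRatio_lt_one hqp (by linarith [hx.1]) hx.2
    have py := genChooseRatio_lt_one hqp (by linarith [hy.1]) hy.2
    have hl := strictConcaveOn_log_Ioi.concaveOn.2 (x := 1 - genChooseRatio q p x)
      (y := 1 - genChooseRatio q p y) (sub_pos.2 px) (sub_pos.2 py) ha hb hab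
    have hpos := (convex_Ioi (0 : ℝ)) (x := 1 - genChooseRatio q p x)
      (y := 1 - genChooseRatio q p y) (sub_pos.2 px) (sub_pos.2 py) ha hb hab
    simp only [smul_eq_mul] at *
    exact hl.trans (Real.log_le_log hpos (by linarith))
  refine (h1.add h2).congr fun x hx => ?_
  have px := genChooseRatio_lt_one hqp (by linarith [hx.1]) hx.2
  rw [genChoose_eq_mul_ratio hqp.le x, ← mul_one_sub, Real.log_mul
    (genChoose_pos (by linarith [hx.1])).ne' (by linarith)]
  rfl

lemma genChoose_sub_eq {q p : ℕ} (hq : 0 < q) (hqp : q < p) :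
    genChoose ((p : ℝ) + q - 2) q - genChoose ((p : ℝ) + q - 2) p =
      genChoose ((p : ℝ) + q - 1) q - genChoose ((p : ℝ) + q - 1) p := by
  obtain ⟨q, rfl⟩ := Nat.exists_eq_add_of_le' hq
  obtain ⟨p, rfl⟩ := Nat.exists_eq_add_of_le' (hq.trans hqp)
  have e : ((p + 1 : ℕ) : ℝ) + (q + 1 : ℕ) - 2 = ((p + q : ℕ) : ℝ) := by push_cast; ring
  have e' : ((p + 1 : ℕ) : ℝ) + (q + 1 : ℕ) - 1 = ((p + q + 1 : ℕ) : ℝ) := by push_cast; ring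
  have h := Nat.choose_symm_add (a := p) (b := q)
  rw [e, e', genChoose_natCast, genChoose_natCast, genChoose_natCast, genChoose_natCast,
    Nat.choose_succ_succ, Nat.choose_succ_succ, h]
  push_cast
  ring

/-- The function `C(x, q) - C(x, p)` is log-concave and takes the same value at
`p + q - 2` and `p + q - 1`, so it is increasing up to `p + q - 2`. -/
lemma genChoose_sub_mono {q p : ℕ} (hq : 2 ≤ q) (hqp : q < p) {x y : ℝ} (hx : (p : ℝ) ≤ x)
    (hxs : x ≤ p + q - 2) (hxy : x ≤ y) (hy : y ≤ p + q - 1) :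
    genChoose x q - genChoose x p ≤ genChoose y q - genChoose y p := by
  have hc := (concaveOn_log_genChoose_sub hqp).quasiconcaveOn
  have hL := concaveOn_log_genChoose_sub hqp
  have hend := genChoose_sub_eq (by omega) hqp
  set L := fun x => Real.log (genChoose x q - genChoose x p) with hLdef
  have hq' : (2 : ℝ) ≤ q := by exact_mod_cast hq
  have hLend : L (p + q - 2) = L (p + q - 1) := by simp only [hLdef, hend]
  have m1 : x ∈ Set.Ico (p : ℝ) (p + q) := ⟨hx, by linarith⟩
  have m2 : (p : ℝ) + q - 1 ∈ Set.Ico (p : ℝ) (p + q) := ⟨by linarith, by linarith⟩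
  have hxc : L x ≤ L (p + q - 1) := by
    rw [← hLend]
    exact hL.left_le_of_le_right'' (y := (p : ℝ) + q - 2) m1 m2 hxs (by linarith) hLend.le
  have hlog : L x ≤ L y := by
    have := hc (L x) |>.ordConnected.out ⟨m1, le_rfl⟩ ⟨m2, hxc⟩ ⟨hxy, hy⟩
    exact this.2
  exact (Real.log_le_log_iff (genChoose_sub_pos hqp (by linarith) (by linarith))
    (genChoose_sub_pos hqp (by linarith) (by linarith))).1 hlog

/-- A family is shifted above `s` if replacing an element of a member by a smaller element
that is at least `s` gives another member. -/
def IsShifted (s : ℕ) (F : Finset (Finset ℕ)) : Prop :=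
  ∀ A ∈ F, ∀ i j, s ≤ i → i < j → i ∉ A → j ∈ A → insert i (A.erase j) ∈ F

section Shift

open scoped FinsetFamily

lemma compress_singleton {i j : ℕ} {A : Finset ℕ} (hij : i ≠ j) (hi : i ∉ A) (hj : j ∈ A) :
    UV.compress {i} {j} A = insert i (A.erase j) := by
  rw [UV.compress_of_disjoint_of_le (by simpa using hi) (by simpa using hj)]
  ext x
  simp only [sup_eq_union, mem_sdiff, mem_union, mem_singleton, mem_insert, mem_erase]
  grind

lemma compress_singleton_of_not {i j : ℕ} {A : Finset ℕ} (h : ¬(i ∉ A ∧ j ∈ A)) :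
    UV.compress {i} {j} A = A := by
  unfold UV.compress
  rw [if_neg]
  simpa using h

lemma exists_of_mem_shift {i j : ℕ} {F : Finset (Finset ℕ)} {A : Finset ℕ} (hij : i ≠ j)
    (hA : A ∈ 𝓒 {i} {j} F) :
    (A ∈ F ∧ (i ∉ A → j ∈ A → insert i (A.erase j) ∈ F)) ∨
      ∃ B ∈ F, i ∉ B ∧ j ∈ B ∧ A = insert i (B.erase j) := by
  rcases UV.mem_compression.1 hA with ⟨h1, h2⟩ | ⟨h1, B, hB, rfl⟩
  · exact Or.inl ⟨h1, fun hi hj => by rwa [compress_singleton hij hi hj] at h2⟩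
  · by_cases h : i ∉ B ∧ j ∈ B
    · exact Or.inr ⟨B, hB, h.1, h.2, compress_singleton hij h.1 h.2⟩
    · rw [compress_singleton_of_not h] at h1
      exact absurd hB h1

lemma subset_of_mem_shift {i j : ℕ} {F : Finset (Finset ℕ)} {V : Finset ℕ} {k : ℕ} (hij : i ≠ j)
    (hi : i ∈ V) (hF : F ⊆ V.powersetCard k) : 𝓒 {i} {j} F ⊆ V.powersetCard k := by
  intro A hA
  rcases exists_of_mem_shift hij hA with h | ⟨B, hB, hiB, hjB, rfl⟩
  · exact hF h.1
  · obtain ⟨h1, h2⟩ := mem_powersetCard.1 (hF hB)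
    refine mem_powersetCard.2 ⟨insert_subset hi ((erase_subset _ _).trans h1), ?_⟩
    rw [card_insert_of_notMem (by simp [hiB]), card_erase_add_one hjB, h2]

lemma intersecting_shift {i j : ℕ} {F : Finset (Finset ℕ)} (hij : i ≠ j)
    (hint : ∀ A ∈ F, ∀ B ∈ F, (A ∩ B).Nonempty) :
    ∀ A ∈ 𝓒 {i} {j} F, ∀ B ∈ 𝓒 {i} {j} F, (A ∩ B).Nonempty := by
  have mixed : ∀ A ∈ F, (i ∉ A → j ∈ A → insert i (A.erase j) ∈ F) → ∀ B ∈ F, i ∉ B → j ∈ B →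
      (A ∩ insert i (B.erase j)).Nonempty := by
    intro A hA hA' B hB hiB hjB
    by_cases hiA : i ∈ A
    · exact ⟨i, by simp [hiA]⟩
    by_cases hjA : j ∈ A
    · obtain ⟨x, hx⟩ := hint _ (hA' hiA hjA) B hB
      simp only [mem_inter, mem_insert, mem_erase] at hx
      exact ⟨x, by simp only [mem_inter, mem_insert, mem_erase]; grind⟩
    · obtain ⟨x, hx⟩ := hint A hA B hB
      simp only [mem_inter] at hx
      exact ⟨x, by simp only [mem_inter, mem_insert, mem_erase]; grind⟩
  intro A hA B hB
  rcases exists_of_mem_shift hij hA with hA | ⟨A', hA', hiA, hjA, rfl⟩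
  · rcases exists_of_mem_shift hij hB with hB | ⟨B', hB', hiB, hjB, rfl⟩
    · exact hint A hA.1 B hB.1
    · exact mixed A hA.1 hA.2 B' hB' hiB hjB
  · rcases exists_of_mem_shift hij hB with hB | ⟨B', hB', hiB, hjB, rfl⟩
    · rw [inter_comm]
      exact mixed B hB.1 hB.2 A' hA' hiA hjA
    · exact ⟨i, by simp⟩

lemma card_avoiding_le_card_avoiding_shift {i j x : ℕ} (F : Finset (Finset ℕ)) (hij : i ≠ j)
    (hx : x ≠ i) : #{A ∈ F | x ∉ A} ≤ #{A ∈ 𝓒 {i} {j} F | x ∉ A} := by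
  refine card_le_card_of_injOn
    (fun A => if UV.compress {i} {j} A ∈ F then A else UV.compress {i} {j} A) ?_ ?_
  · intro A hA
    obtain ⟨hA, hxA⟩ := mem_filter.1 hA
    dsimp only
    split_ifs with h
    · exact mem_coe.2 (mem_filter.2 ⟨UV.mem_compression.2 (Or.inl ⟨hA, h⟩), hxA⟩)
    · refine mem_coe.2 (mem_filter.2 ⟨UV.mem_compression.2 (Or.inr ⟨h, A, hA, rfl⟩), ?_⟩)
      by_cases h' : i ∉ A ∧ j ∈ A
      · rw [compress_singleton hij h'.1 h'.2]
        simp [hx, hxA]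
      · rwa [compress_singleton_of_not h']
  · intro A hA B hB hAB
    have hA := (mem_filter.1 hA).1
    have hB := (mem_filter.1 hB).1
    dsimp only at hAB
    split_ifs at hAB with h1 h2 h2
    · exact hAB
    · exact absurd (hAB ▸ hA) h2
    · exact absurd (hAB ▸ hB) h1
    · exact UV.compress_injOn (mem_filter.2 ⟨hA, h1⟩) (mem_filter.2 ⟨hB, h2⟩) hAB

lemma card_avoiding_pair_le_card_avoiding_shift {i j : ℕ} (F : Finset (Finset ℕ)) :
    #{A ∈ F | i ∉ A ∧ j ∉ A} ≤ #{A ∈ 𝓒 {i} {j} F | i ∉ A} := by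
  refine card_le_card fun A hA => ?_
  obtain ⟨hA, hi, hj⟩ := mem_filter.1 hA
  refine mem_filter.2 ⟨UV.mem_compression.2 (Or.inl ⟨hA, ?_⟩), hi⟩
  rwa [compress_singleton_of_not (by tauto)]

lemma sum_shift_lt {i j : ℕ} {F : Finset (Finset ℕ)} {A : Finset ℕ} (hij : i < j) (hA : A ∈ F)
    (hi : i ∉ A) (hj : j ∈ A) (hA' : insert i (A.erase j) ∉ F) :
    ∑ B ∈ 𝓒 {i} {j} F, ∑ x ∈ B, x < ∑ B ∈ F, ∑ x ∈ B, x := by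
  have hlt : ∀ B : Finset ℕ, i ∉ B → j ∈ B → ∑ x ∈ UV.compress {i} {j} B, x < ∑ x ∈ B, x := by
    intro B hi hj
    rw [compress_singleton hij.ne hi hj, sum_insert (by simp [hi]), ← add_sum_erase B (fun x => x) hj]
    simpa using hij
  have hle : ∀ B : Finset ℕ, ∑ x ∈ UV.compress {i} {j} B, x ≤ ∑ x ∈ B, x := by
    intro B
    by_cases h : i ∉ B ∧ j ∈ B
    · exact (hlt B h.1 h.2).le
    · rw [compress_singleton_of_not h]
  have hU : 𝓒 {i} {j} F = {B ∈ F | UV.compress {i} {j} B ∈ F} ∪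
      {B ∈ F | UV.compress {i} {j} B ∉ F}.image (UV.compress {i} {j}) := by
    rw [UV.compression, filter_image]
  rw [hU, sum_union, sum_image UV.compress_injOn,
    ← sum_filter_add_sum_filter_not F (fun B => UV.compress {i} {j} B ∈ F) fun B => ∑ x ∈ B, x]
  · refine Nat.add_lt_add_left (sum_lt_sum (fun B _ => hle B) ⟨A, ?_, hlt A hi hj⟩) _
    rw [mem_filter, compress_singleton hij.ne hi hj]
    exact ⟨hA, hA'⟩
  · rw [disjoint_left]
    intro B hB hB'
    obtain ⟨C, hC, rfl⟩ := mem_image.1 hB'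
    exact (mem_filter.1 hC).2 (mem_filter.1 hB).1

/-- To prove a property for all families it suffices to prove it for shifted families and to pull
it back along shifts. -/
lemma shift_induction {P : Finset (Finset ℕ) → Prop} (s : ℕ) (base : ∀ F, IsShifted s F → P F)
    (step : ∀ F i j, s ≤ i → i < j → (∃ A ∈ F, j ∈ A) → P (𝓒 {i} {j} F) → P F)
    (F : Finset (Finset ℕ)) : P F := by
  induction hm : ∑ B ∈ F, ∑ x ∈ B, x using Nat.strong_induction_on generalizing F with
  | _ m ih =>
    by_cases h : IsShifted s F
    · exact base F h
    · unfold IsShifted at h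
      push Not at h
      obtain ⟨A, hA, i, j, hs, hij, hi, hj, hA'⟩ := h
      exact step F i j hs hij ⟨A, hA, hj⟩ (ih _ (hm ▸ sum_shift_lt hij hA hi hj hA') _ rfl)

lemma IsShifted.insert_erase_mem_nonMemberSubfamily {s a i j : ℕ} {F : Finset (Finset ℕ)} {A : Finset ℕ}
    (h : IsShifted s F) (hA : A ∈ F.nonMemberSubfamily a) (hs : s ≤ i) (hij : i < j) (hia : i ≠ a)
    (hi : i ∉ A) (hj : j ∈ A) : insert i (A.erase j) ∈ F.nonMemberSubfamily a := by
  rw [Finset.mem_nonMemberSubfamily] at hA ⊢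
  refine ⟨h A hA.1 i j hs hij hi hj, ?_⟩
  simp only [mem_insert, mem_erase]
  grind

lemma IsShifted.insert_erase_mem_memberSubfamily {s a i j : ℕ} {F : Finset (Finset ℕ)} {A : Finset ℕ}
    (h : IsShifted s F) (hA : A ∈ F.memberSubfamily a) (hs : s ≤ i) (hij : i < j) (hia : i ≠ a)
    (hi : i ∉ A) (hj : j ∈ A) : insert i (A.erase j) ∈ F.memberSubfamily a := by
  rw [Finset.mem_memberSubfamily] at hA ⊢
  have hja : j ≠ a := fun e => hA.2 (e ▸ hj)
  refine ⟨?_, by simp only [mem_insert, mem_erase]; grind⟩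
  rw [insert_comm, ← erase_insert_of_ne hja.symm]
  exact h _ hA.1 i j hs hij (by simp [hi, hia]) (by simp [hj])

end Shift

section Lovasz

open scoped FinsetFamily

lemma card_shadow_shifted (d : ℕ) {s r : ℕ} {x : ℝ} {F : Finset (Finset ℕ)}
    (hF : F ⊆ (Ico s (s + d)).powersetCard (r + 1)) (hS : IsShifted s F) (hx : (r : ℝ) + 1 ≤ x)
    (hcard : genChoose x (r + 1) ≤ #F) : genChoose x r ≤ #(∂ F) := by
  induction d generalizing s r x F with
  | zero =>
    have hF' : F = ∅ := by
      rw [← subset_empty]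
      refine hF.trans ?_
      simp
    subst hF'
    have := genChoose_pos (x := x) (m := r + 1) (by push_cast; linarith)
    simp at hcard
    linarith
  | succ d ih =>
    have hpos : 0 < genChoose x (r + 1) := genChoose_pos (by push_cast; linarith)
    have hne : F.Nonempty := card_pos.1 (by exact_mod_cast hpos.trans_le hcard)
    cases r with
    | zero =>
      obtain ⟨A, hA⟩ := hne
      obtain ⟨a, rfl⟩ := card_eq_one.1 (mem_powersetCard.1 (hF hA)).2
      rw [genChoose_zero]
      exact_mod_cast card_pos.2 ⟨_, erase_mem_shadow hA (mem_singleton_self a)⟩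
    | succ r =>
      set F₁ := F.memberSubfamily s with hF₁
      set F₀ := F.nonMemberSubfamily s with hF₀
      have hIco : Ico s (s + (d + 1)) = insert s (Ico (s + 1) (s + 1 + d)) := by
        ext x; simp only [mem_Ico, mem_insert]; omega
      have h₁ : F₁ ⊆ (Ico (s + 1) (s + 1 + d)).powersetCard (r + 1) := by
        intro A hA
        obtain ⟨hA, hsA⟩ := mem_memberSubfamily.1 hA
        obtain ⟨h1, h2⟩ := mem_powersetCard.1 (hF hA)
        rw [card_insert_of_notMem hsA] at h2
        rw [hIco] at h1
        exact mem_powersetCard.2 ⟨(insert_subset_insert_iff hsA).1 h1, by omega⟩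
      have h₀ : F₀ ⊆ (Ico (s + 1) (s + 1 + d)).powersetCard (r + 1 + 1) := by
        intro A hA
        obtain ⟨hA, hsA⟩ := mem_nonMemberSubfamily.1 hA
        obtain ⟨h1, h2⟩ := mem_powersetCard.1 (hF hA)
        rw [hIco] at h1
        exact mem_powersetCard.2 ⟨(subset_insert_iff_of_notMem hsA).1 h1, h2⟩
      have hS₁ : IsShifted (s + 1) F₁ := fun A hA i j hi hij hiA hjA =>
        hS.insert_erase_mem_memberSubfamily hA (by omega) hij (by omega) hiA hjA
      have hS₀ : IsShifted (s + 1) F₀ := fun A hA i j hi hij hiA hjA =>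
        hS.insert_erase_mem_nonMemberSubfamily hA (by omega) hij (by omega) hiA hjA
      have hsub : ∂ F₀ ⊆ F₁ := by
        intro B hB
        obtain ⟨A, hA, a, ha, rfl⟩ := mem_shadow_iff.1 hB
        have hA' := mem_nonMemberSubfamily.1 hA
        have has : s < a := by
          have := (mem_powersetCard.1 (h₀ hA)).1 ha
          simp at this; omega
        exact mem_memberSubfamily.2 ⟨hS A hA'.1 s a le_rfl has hA'.2 ha, by simp [hA'.2]⟩
      have hsum : #F₁ + #F₀ = #F := card_memberSubfamily_add_card_nonMemberSubfamily s F
      have hbig : genChoose (x - 1) (r + 1) ≤ #F₁ := by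
        by_contra! hlt
        have hF₀c : genChoose (x - 1) (r + 1 + 1) < #F₀ := by
          have hsum' : (#F₁ : ℝ) + #F₀ = #F := by exact_mod_cast hsum
          rw [genChoose_pascal] at hcard
          linarith
        have hsub' : (#(∂ F₀) : ℝ) ≤ #F₁ := by exact_mod_cast card_le_card hsub
        push_cast at hx
        rcases le_or_gt ((r : ℝ) + 1 + 1) (x - 1) with h | h
        · have := ih h₀ hS₀ (by push_cast; exact h) hF₀c.le
          linarith
        · have h1 : (1 : ℝ) ≤ #F₀ := by
            have : (0 : ℝ) < #F₀ :=
              (genChoose_nonneg (by push_cast; linarith)).trans_lt hF₀c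
            exact_mod_cast this
          have := ih (x := ((r + 1 + 1 : ℕ) : ℝ)) h₀ hS₀ (by push_cast; exact le_rfl) (by
            rw [genChoose_natCast, Nat.choose_self]; exact_mod_cast h1)
          have h3 : genChoose (x - 1) (r + 1) ≤ genChoose ((r + 1 + 1 : ℕ) : ℝ) (r + 1) :=
            genChoose_le_genChoose (by push_cast; linarith) (by push_cast; linarith)
          linarith
      have hsh := ih h₁ hS₁ (x := x - 1) (by push_cast at hx; linarith) hbig
      have e1 : F₁ ⊆ (∂ F).nonMemberSubfamily s := by
        intro A hA
        obtain ⟨hA, hsA⟩ := mem_memberSubfamily.1 hA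
        exact mem_nonMemberSubfamily.2 ⟨mem_shadow_iff_insert_mem.2 ⟨s, hsA, hA⟩, hsA⟩
      have e2 : ∂ F₁ ⊆ (∂ F).memberSubfamily s := by
        intro B hB
        obtain ⟨a, haB, hA⟩ := mem_shadow_iff_insert_mem.1 hB
        obtain ⟨hA, hsA⟩ := mem_memberSubfamily.1 hA
        simp only [mem_insert, not_or] at hsA
        refine mem_memberSubfamily.2 ⟨mem_shadow_iff_insert_mem.2 ⟨a, ?_, ?_⟩, hsA.2⟩
        · simp [haB, Ne.symm hsA.1]
        · rwa [insert_comm]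
      have := card_memberSubfamily_add_card_nonMemberSubfamily s (∂ F)
      have : #(∂ F₁) + #F₁ ≤ #(∂ F) := by
        rw [← this]; exact add_le_add (card_le_card e2) (card_le_card e1)
      have : (#(∂ F₁) : ℝ) + #F₁ ≤ #(∂ F) := by exact_mod_cast this
      rw [genChoose_pascal]
      linarith

/-- Lovász's form of the Kruskal–Katona theorem, with a real parameter. -/
lemma card_shadow_lovasz {r : ℕ} {x : ℝ} {F : Finset (Finset ℕ)}
    (hF : (F : Set (Finset ℕ)).Sized (r + 1)) (hx : (r : ℝ) + 1 ≤ x)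
    (hcard : genChoose x (r + 1) ≤ #F) : genChoose x r ≤ #(∂ F) := by
  induction F using shift_induction 0 with
  | base F hS =>
    refine card_shadow_shifted ((F.biUnion id).sup id + 1) (s := 0) ?_ hS hx hcard
    intro A hA
    refine mem_powersetCard.2 ⟨fun a ha => ?_, hF hA⟩
    have : a ≤ (F.biUnion id).sup id := le_sup (f := id) (mem_biUnion.2 ⟨A, hA, ha⟩)
    exact mem_Ico.2 ⟨Nat.zero_le _, by omega⟩
  | step F i j _ hij _ ih =>
    refine (ih (hF.uvCompression (by simp)) (by rwa [UV.card_compression])).trans ?_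
    have := UV.card_shadow_compression_le {i} {j} (𝒜 := F) (by
      intro a ha
      refine ⟨j, mem_singleton_self j, ?_⟩
      rw [mem_singleton.1 ha, erase_singleton, erase_singleton]
      exact UV.isCompressed_self _ _)
    exact_mod_cast this

lemma card_shadow_iterate_lovasz (t : ℕ) {r : ℕ} {x : ℝ} {F : Finset (Finset ℕ)}
    (hF : (F : Set (Finset ℕ)).Sized (r + t)) (hx : (r : ℝ) + t ≤ x)
    (hcard : genChoose x (r + t) ≤ #F) : genChoose x r ≤ #(∂^[t] F) := by
  induction t generalizing F with
  | zero => simpa using hcard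
  | succ t ih =>
    rw [Function.iterate_succ_apply]
    push_cast at hx
    refine ih hF.shadow (by linarith) ?_
    exact card_shadow_lovasz (r := r + t) hF (by push_cast; linarith) hcard

/-- Bound for the size of a family cross-intersecting a given large family. -/
lemma card_add_genChoose_le_of_cross {V : Finset ℕ} {a b : ℕ} {x : ℝ} {A B : Finset (Finset ℕ)}
    (hab : a + b ≤ #V) (hA : A ⊆ V.powersetCard a) (hB : B ⊆ V.powersetCard b)
    (hcross : ∀ S ∈ A, ∀ T ∈ B, (S ∩ T).Nonempty) (hx : (#V : ℝ) - b ≤ x)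
    (hcard : genChoose x (#V - b) ≤ #B) : #A + genChoose x a ≤ (#V).choose a := by
  obtain ⟨t, ht⟩ : ∃ t, #V - b = a + t := ⟨#V - b - a, by omega⟩
  set B' := B.image (V \ ·) with hB'
  have hB'c : #B' = #B := by
    refine card_image_of_injOn fun S hS T hT hST => ?_
    have hS := (mem_powersetCard.1 (hB hS)).1
    have hT := (mem_powersetCard.1 (hB hT)).1
    rw [← Finset.sdiff_sdiff_eq_self hS, show V \ S = V \ T from hST, Finset.sdiff_sdiff_eq_self hT]
  have hsized : (B' : Set (Finset ℕ)).Sized (a + t) := by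
    intro S hS
    obtain ⟨T, hT, rfl⟩ := mem_image.1 (mem_coe.1 hS)
    obtain ⟨h1, h2⟩ := mem_powersetCard.1 (hB hT)
    rw [card_sdiff_of_subset h1, h2, ht]
  have hVb : (#V : ℝ) - b = a + t := by
    rw [← Nat.cast_sub (by omega), ht]; push_cast; rfl
  have hs := card_shadow_iterate_lovasz t hsized (hVb ▸ hx) (by rwa [hB'c, ← ht])
  have hsub : A ∪ ∂^[t] B' ⊆ V.powersetCard a := by
    refine union_subset hA fun S hS => ?_
    have hc := hsized.shadow_iterate (mem_coe.2 hS)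
    obtain ⟨T, hT, hST, -⟩ := mem_shadow_iterate_iff_exists_sdiff.1 hS
    obtain ⟨T, -, rfl⟩ := mem_image.1 hT
    exact mem_powersetCard.2 ⟨hST.trans sdiff_subset, by omega⟩
  have hdisj : Disjoint A (∂^[t] B') := by
    rw [disjoint_left]
    intro S hS hS'
    obtain ⟨_, hU, hST, -⟩ := mem_shadow_iterate_iff_exists_sdiff.1 hS'
    obtain ⟨T, hT, rfl⟩ := mem_image.1 hU
    obtain ⟨z, hz⟩ := hcross S hS T hT
    have hz := mem_inter.1 hz
    exact (mem_sdiff.1 (hST hz.1)).2 hz.2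
  have := card_le_card hsub
  rw [card_union_of_disjoint hdisj, card_powersetCard] at this
  have : (#A : ℝ) + #(∂^[t] B') ≤ (#V).choose a := by exact_mod_cast this
  linarith

end Lovasz

section Cross

lemma card_add_card_le_of_cross {V : Finset ℕ} {p q b : ℕ} {y : ℝ} {A B : Finset (Finset ℕ)}
    (hq : 2 ≤ q) (hqp : q < p) (hV : #V = p + b) (hA : A ⊆ V.powersetCard q)
    (hB : B ⊆ V.powersetCard b) (hcross : ∀ S ∈ A, ∀ T ∈ B, (S ∩ T).Nonempty)
    (hpy : (p : ℝ) ≤ y) (hy : y ≤ p + q - 2) (hyB : genChoose y p ≤ #B)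
    (hBle : #B ≤ (p + q - 1).choose p) :
    (#A : ℝ) + #B ≤ (#V).choose q - (genChoose y q - genChoose y p) := by
  have e : ((p + q - 1 : ℕ) : ℝ) = p + q - 1 := by
    rw [Nat.cast_sub (by omega)]; push_cast; ring
  have hb : #V - b = p := by omega
  obtain ⟨x, hyx, hx, hxB⟩ := exists_genChoose_eq (b := (p : ℝ) + q - 1) (by linarith) hyB
    (by rw [← e, genChoose_natCast]; exact_mod_cast hBle)
  have h1 := card_add_genChoose_le_of_cross (x := x) (by omega) hA hB hcross
    (by rw [hV]; push_cast; linarith) (by rw [hb, hxB])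
  have h2 := genChoose_sub_mono hq hqp hpy hy hyx hx
  linarith

variable {N m : ℕ} {V : Finset ℕ} {A B : Finset (Finset ℕ)}

lemma card_add_card_le_of_cross_same_size (hNm : 2 * m + 3 ≤ N) (hV : #V = N + 2)
    (hA : A ⊆ V.powersetCard (m + 2)) (hB : B ⊆ V.powersetCard (m + 2))
    (hcross : ∀ S ∈ A, ∀ T ∈ B, (S ∩ T).Nonempty)
    (hcA : N.choose m ≤ #A) (hcB : N.choose m ≤ #B) :
    #A + #B ≤ 2 * (N + 1).choose (m + 1) := by
  wlog hBA : #B ≤ #A generalizing A B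
  · rw [add_comm]
    exact this hB hA (fun S hS T hT => by rw [inter_comm]; exact hcross T hT S hS) hcB hcA
      (le_of_not_ge hBA)
  obtain ⟨p, rfl⟩ : ∃ p, N = p + m := ⟨N - m, by omega⟩
  have s1 : (p + m + 1).choose p = (p + m + 1).choose (m + 1) := by
    rw [add_assoc]; exact Nat.choose_symm_add
  have s2 : (p + m).choose p = (p + m).choose m := Nat.choose_symm_add
  have hBle : #B ≤ (p + m + 1).choose p := by
    by_contra! hlt
    have h := card_add_genChoose_le_of_cross (x := ((p + m + 1 : ℕ) : ℝ)) (by omega) hA hB hcross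
      (by rw [hV]; push_cast; linarith)
      (by rw [genChoose_natCast, show #V - (m + 2) = p by omega]; exact_mod_cast hlt.le)
    rw [genChoose_natCast, hV, Nat.choose_succ_succ (p + m + 1)] at h
    have h : #A + (p + m + 1).choose (m + 2) ≤
      (p + m + 1).choose (m + 1) + (p + m + 1).choose (m + 2) := by exact_mod_cast h
    omega
  have h := card_add_card_le_of_cross (p := p) (y := ((p + m : ℕ) : ℝ)) (by omega) (by omega)
    (by omega) hA hB hcross (by push_cast; linarith [Nat.cast_nonneg (α := ℝ) m])
    (by push_cast; linarith) (by rw [genChoose_natCast, s2]; exact_mod_cast hcB) hBle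
  rw [genChoose_natCast, genChoose_natCast, s2, hV, Nat.choose_succ_succ, Nat.choose_succ_succ,
    Nat.choose_succ_succ (p + m) (m + 1)] at h
  push_cast at h
  have h3 : ((#A + #B : ℕ) : ℝ) ≤ ((2 * ((p + m).choose m + (p + m).choose (m + 1)) : ℕ) : ℝ) := by
    push_cast; linarith
  rw [Nat.choose_succ_succ]
  exact_mod_cast h3

lemma card_add_card_le_of_cross_of_small (hNm : 2 * m + 3 ≤ N) (hV : #V = N + 2)
    (hA : A ⊆ V.powersetCard (m + 1)) (hB : B ⊆ V.powersetCard (m + 3))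
    (hcross : ∀ S ∈ A, ∀ T ∈ B, (S ∩ T).Nonempty) (hcB : #B ≤ N.choose m) :
    #A + #B ≤ (N + 2).choose (m + 1) := by
  rcases B.eq_empty_or_nonempty with rfl | hne
  · simpa [hV] using card_le_card hA
  obtain ⟨p, rfl⟩ : ∃ p, N = p + (m + 1) := ⟨N - (m + 1), by omega⟩
  have hm : (p + (m + 1)).choose m ≤ (p + (m + 1)).choose (m + 1) :=
    Nat.choose_le_succ_of_lt_half_left (by omega)
  have hb : #V - (m + 3) = p := by omega
  have h1 : (1 : ℝ) ≤ #B := by exact_mod_cast card_pos.2 hne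
  obtain ⟨x, hpx, hx, hxB⟩ := exists_genChoose_eq (a := (p : ℝ)) (g := #B) (m := p)
    (b := ((p + (m + 1) : ℕ) : ℝ)) (by exact_mod_cast Nat.le_add_right _ _)
    (by rw [genChoose_natCast, Nat.choose_self]; exact_mod_cast h1)
    (by rw [genChoose_natCast, Nat.choose_symm_add]; exact_mod_cast hcB.trans hm)
  have h2 := card_add_genChoose_le_of_cross (x := x) (by omega) hA hB hcross
    (by rw [hV]; push_cast; linarith) (by rw [hb, hxB])
  have h3 := genChoose_le_of_le_add (q := m + 1) (p := p) (by omega) (x := x) (by linarith)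
    (by push_cast at hx ⊢; linarith)
  rw [hV] at h2
  have : ((#A + #B : ℕ) : ℝ) ≤ ((p + (m + 1) + 2).choose (m + 1) : ℕ) := by push_cast; linarith
  exact_mod_cast this

end Cross

section Shifted

/-- A shifted `(t + 1)`-intersecting family of `(a + t)`-sets is at most as large as the family of
`a`-sets that are disjoint from one of its members. -/
lemma IsShifted.card_le_card_disjoint (d : ℕ) {s a t : ℕ} {Y : Finset (Finset ℕ)}
    (hY : Y ⊆ (Ico s (s + d)).powersetCard (a + t)) (hS : IsShifted s Y) (hd : 2 * a + t ≤ d)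
    (hint : ∀ A ∈ Y, ∀ B ∈ Y, t + 1 ≤ #(A ∩ B)) :
    #Y ≤ #{G ∈ (Ico s (s + d)).powersetCard a | ∃ T ∈ Y, Disjoint G T} := by
  induction d generalizing a Y with
  | zero =>
    have : Y = ∅ := by
      refine eq_empty_of_forall_notMem fun A hA => ?_
      have h1 := hint A hA A hA
      have h2 := (mem_powersetCard.1 (hY hA)).2
      rw [inter_self] at h1
      omega
    simp [this]
  | succ d ih =>
    rcases eq_or_lt_of_le hd with hd | hd
    · refine card_le_card_of_injOn (Ico s (s + (d + 1)) \ ·) ?_ ?_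
      · intro A hA
        obtain ⟨h1, h2⟩ := mem_powersetCard.1 (hY hA)
        refine mem_coe.2 (mem_filter.2 ⟨mem_powersetCard.2 ⟨sdiff_subset, ?_⟩, A, hA,
          sdiff_disjoint⟩)
        rw [card_sdiff_of_subset h1, h2, Nat.card_Ico]
        omega
      · intro A hA B hB hAB
        have hA := (mem_powersetCard.1 (hY hA)).1
        have hB := (mem_powersetCard.1 (hY hB)).1
        rw [← Finset.sdiff_sdiff_eq_self hA,
          show Ico s (s + (d + 1)) \ A = Ico s (s + (d + 1)) \ B from hAB,
          Finset.sdiff_sdiff_eq_self hB]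
    rcases a with _ | a
    · have : Y = ∅ := by
        refine eq_empty_of_forall_notMem fun A hA => ?_
        have h1 := hint A hA A hA
        have h2 := (mem_powersetCard.1 (hY hA)).2
        rw [inter_self] at h1
        omega
      simp [this]
    set D := {G ∈ (Ico s (s + (d + 1))).powersetCard (a + 1) | ∃ T ∈ Y, Disjoint G T} with hD
    have hIco : Ico s (s + (d + 1)) = insert (s + d) (Ico s (s + d)) := by
      ext x; simp only [mem_Ico, mem_insert]; omega
    have hnot : s + d ∉ Ico s (s + d) := by simp
    have h₁ : Y.memberSubfamily (s + d) ⊆ (Ico s (s + d)).powersetCard (a + t) := by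
      intro A hA
      obtain ⟨hA, hsA⟩ := mem_memberSubfamily.1 hA
      obtain ⟨h1, h2⟩ := mem_powersetCard.1 (hY hA)
      rw [card_insert_of_notMem hsA] at h2
      rw [hIco] at h1
      exact mem_powersetCard.2 ⟨(insert_subset_insert_iff hsA).1 h1, by omega⟩
    have h₀ : Y.nonMemberSubfamily (s + d) ⊆ (Ico s (s + d)).powersetCard (a + 1 + t) := by
      intro A hA
      obtain ⟨hA, hsA⟩ := mem_nonMemberSubfamily.1 hA
      obtain ⟨h1, h2⟩ := mem_powersetCard.1 (hY hA)
      rw [hIco] at h1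
      exact mem_powersetCard.2 ⟨(subset_insert_iff_of_notMem hsA).1 h1, h2⟩
    have hS₁ : IsShifted s (Y.memberSubfamily (s + d)) := fun A hA i j hi hij hiA hjA => by
      have := mem_Ico.1 ((mem_powersetCard.1 (h₁ hA)).1 hjA)
      exact hS.insert_erase_mem_memberSubfamily hA (by omega) hij (by omega) hiA hjA
    have hS₀ : IsShifted s (Y.nonMemberSubfamily (s + d)) := fun A hA i j hi hij hiA hjA => by
      have := mem_Ico.1 ((mem_powersetCard.1 (h₀ hA)).1 hjA)
      exact hS.insert_erase_mem_nonMemberSubfamily hA (by omega) hij (by omega) hiA hjA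
    have hfree : ∀ U : Finset ℕ, #U < d → ∃ x, s ≤ x ∧ x < s + d ∧ x ∉ U := by
      intro U hU
      obtain ⟨x, hx, hxU⟩ := exists_mem_notMem_of_card_lt_card (s := U) (t := Ico s (s + d))
        (by simpa using hU)
      exact ⟨x, (mem_Ico.1 hx).1, (mem_Ico.1 hx).2, hxU⟩
    have hmove : ∀ A ∈ Y.memberSubfamily (s + d), ∀ x, s ≤ x → x < s + d → x ∉ A →
        insert x A ∈ Y := by
      intro A hA x hsx hxd hxA
      obtain ⟨hA, hdA⟩ := mem_memberSubfamily.1 hA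
      have := hS _ hA x (s + d) hsx hxd (by simp [hxA]; omega) (mem_insert_self _ _)
      rwa [erase_insert hdA] at this
    have hint₁ : ∀ A ∈ Y.memberSubfamily (s + d), ∀ B ∈ Y.memberSubfamily (s + d),
        t + 1 ≤ #(A ∩ B) := by
      intro A hA B hB
      by_contra! hlt
      have hAc := (mem_powersetCard.1 (h₁ hA)).2
      have hBc := (mem_powersetCard.1 (h₁ hB)).2
      have hdA := (mem_memberSubfamily.1 hA).2
      obtain ⟨hB', hdB⟩ := mem_memberSubfamily.1 hB
      have hcov : t + 1 ≤ #(A ∩ B) + 1 := by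
        refine (hint _ (mem_memberSubfamily.1 hA).1 _ hB').trans ?_
        rw [← insert_inter_distrib]
        exact card_insert_le _ _
      have hun := card_union_add_card_inter A B
      obtain ⟨x, hsx, hxd, hx⟩ := hfree (A ∪ B) (by omega)
      rw [mem_union, not_or] at hx
      have := hint _ (hmove A hA x hsx hxd hx.1) _ hB'
      rw [insert_inter_of_notMem (by simp [hx.2]; omega), inter_insert_of_notMem hdA] at this
      omega
    have i₀ := ih h₀ hS₀ (by omega) fun A hA B hB =>
      hint A (mem_nonMemberSubfamily.1 hA).1 B (mem_nonMemberSubfamily.1 hB).1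
    have i₁ := ih h₁ hS₁ (by omega) hint₁
    rw [← card_memberSubfamily_add_card_nonMemberSubfamily (s + d) Y,
      ← card_memberSubfamily_add_card_nonMemberSubfamily (s + d) D]
    refine add_le_add (i₁.trans (card_le_card ?_)) (i₀.trans (card_le_card ?_))
    · intro G hG
      obtain ⟨hG, T, hT, hGT⟩ := mem_filter.1 hG
      obtain ⟨hG, hGc⟩ := mem_powersetCard.1 hG
      have hdG : s + d ∉ G := fun h => hnot (hG h)
      have hTc := (mem_powersetCard.1 (h₁ hT)).2
      obtain ⟨x, hsx, hxd, hx⟩ := hfree (G ∪ T) ((card_union_le _ _).trans_lt (by omega))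
      rw [mem_union, not_or] at hx
      refine mem_memberSubfamily.2 ⟨mem_filter.2 ⟨mem_powersetCard.2 ⟨?_, ?_⟩, insert x T,
        hmove T hT x hsx hxd hx.2, ?_⟩, hdG⟩
      · rw [hIco]
        exact insert_subset_insert _ hG
      · rw [card_insert_of_notMem hdG, hGc]
      · rw [disjoint_insert_left, disjoint_insert_right]
        refine ⟨?_, hx.1, hGT⟩
        rw [mem_insert, not_or]
        exact ⟨by omega, (mem_memberSubfamily.1 hT).2⟩
    · intro G hG
      obtain ⟨hG, T, hT, hGT⟩ := mem_filter.1 hG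
      obtain ⟨hG, hGc⟩ := mem_powersetCard.1 hG
      refine mem_nonMemberSubfamily.2 ⟨mem_filter.2 ⟨mem_powersetCard.2 ⟨?_, hGc⟩, T,
        (mem_nonMemberSubfamily.1 hT).1, hGT⟩, fun h => hnot (hG h)⟩
      rw [hIco]
      exact hG.trans (subset_insert _ _)

lemma IsShifted.card_containing_le {s j : ℕ} {F : Finset (Finset ℕ)} (hS : IsShifted s F)
    (hj : s ≤ j) : #{A ∈ F | j ∈ A} ≤ #{A ∈ F | s ∈ A} := by
  rcases eq_or_lt_of_le hj with rfl | hj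
  · exact le_rfl
  refine card_le_card_of_injOn (fun A => if s ∈ A then A else insert s (A.erase j)) ?_ ?_
  · intro A hA
    obtain ⟨hA, hjA⟩ := mem_filter.1 hA
    dsimp only
    split_ifs with h
    · exact mem_coe.2 (mem_filter.2 ⟨hA, h⟩)
    · exact mem_coe.2 (mem_filter.2 ⟨hS A hA s j le_rfl hj h hjA, mem_insert_self _ _⟩)
  · intro A hA B hB hAB
    have hA := (mem_filter.1 hA).2
    have hB := (mem_filter.1 hB).2
    dsimp only at hAB
    have hsj : j ≠ s := hj.ne'
    split_ifs at hAB with h1 h2 h2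
    · exact hAB
    · rw [hAB] at hA
      simp [hsj] at hA
    · rw [← hAB] at hB
      simp [hsj] at hB
    · have h3 : A.erase j = B.erase j := by
        rw [← erase_insert (a := s) (s := A.erase j) (by simp [h1]), hAB,
          erase_insert (by simp [h2])]
      rw [← insert_erase hA, h3, insert_erase hB]

end Shifted

section Intersecting

open scoped FinsetFamily

lemma memberSubfamily_subset_powersetCard {W : Finset ℕ} {F : Finset (Finset ℕ)} {a : ℕ} (i : ℕ)
    (hF : F ⊆ W.powersetCard (a + 1)) : F.memberSubfamily i ⊆ (W.erase i).powersetCard a := by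
  intro A hA
  obtain ⟨hA, hiA⟩ := mem_memberSubfamily.1 hA
  obtain ⟨h1, h2⟩ := mem_powersetCard.1 (hF hA)
  rw [card_insert_of_notMem hiA] at h2
  exact mem_powersetCard.2
    ⟨subset_erase.2 ⟨(subset_insert _ _).trans h1, hiA⟩, by omega⟩

lemma nonMemberSubfamily_subset_powersetCard {W : Finset ℕ} {F : Finset (Finset ℕ)} {a : ℕ}
    (i : ℕ) (hF : F ⊆ W.powersetCard a) :
    F.nonMemberSubfamily i ⊆ (W.erase i).powersetCard a := by
  intro A hA
  obtain ⟨hA, hiA⟩ := mem_nonMemberSubfamily.1 hA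
  obtain ⟨h1, h2⟩ := mem_powersetCard.1 (hF hA)
  exact mem_powersetCard.2 ⟨subset_erase.2 ⟨h1, hiA⟩, h2⟩

variable {p m : ℕ} {W : Finset ℕ} {F : Finset (Finset ℕ)}

lemma card_le_of_card_nonMemberSubfamily_le {i : ℕ} {y : ℝ} (hmp : m + 2 < p)
    (hW : #W = p + m + 4) (hF : F ⊆ W.powersetCard (m + 3))
    (hint : ∀ A ∈ F, ∀ B ∈ F, (A ∩ B).Nonempty) (hi : i ∈ W) (hpy : (p : ℝ) ≤ y)
    (hy : y ≤ p + m) (hyF : genChoose y p ≤ #(F.nonMemberSubfamily i))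
    (hle : #(F.nonMemberSubfamily i) ≤ (p + m + 1).choose p) :
    (#F : ℝ) ≤ (p + m + 3).choose (m + 2) - (genChoose y (m + 2) - genChoose y p) := by
  have hV : #(W.erase i) = p + m + 3 := by rw [card_erase_of_mem hi, hW]; rfl
  have h := card_add_card_le_of_cross (b := m + 3) (by omega) hmp (by omega)
    (memberSubfamily_subset_powersetCard i hF) (nonMemberSubfamily_subset_powersetCard i hF)
    (fun S hS T hT => ?_) hpy (by push_cast; linarith) hyF hle
  · rw [hV] at h
    rw [← card_memberSubfamily_add_card_nonMemberSubfamily i F]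
    exact_mod_cast h
  · obtain ⟨hT, hiT⟩ := mem_nonMemberSubfamily.1 hT
    have := hint _ (mem_memberSubfamily.1 hS).1 T hT
    rwa [insert_inter_of_notMem hiT] at this

lemma choose_sub_choose_sub_choose (p m : ℕ) :
    ((p + m + 3).choose (m + 2) : ℝ) -
        (genChoose ((p + m : ℕ) : ℝ) (m + 2) - genChoose ((p + m : ℕ) : ℝ) p) =
      ((p + m + 2).choose (m + 1) + 2 * (p + m + 1).choose (m + 1) : ℕ) := by
  rw [genChoose_natCast, genChoose_natCast, Nat.choose_symm_add]
  simp only [Nat.choose_succ_succ]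
  push_cast
  ring

lemma memberSubfamily_nonMemberSubfamily_comm {i j : ℕ} (hij : i ≠ j) (F : Finset (Finset ℕ)) :
    (F.nonMemberSubfamily j).memberSubfamily i = (F.memberSubfamily i).nonMemberSubfamily j := by
  ext A
  simp only [mem_memberSubfamily, mem_nonMemberSubfamily, mem_insert]
  grind

lemma card_le_of_pair {i j : ℕ} (hmp : m + 2 < p) (hW : #W = p + m + 4)
    (hF : F ⊆ W.powersetCard (m + 3)) (hint : ∀ A ∈ F, ∀ B ∈ F, (A ∩ B).Nonempty) (hi : i ∈ W)
    (hj : j ∈ W) (hij : i ≠ j)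
    (h₀ : #((F.memberSubfamily i).memberSubfamily j) +
      #((F.nonMemberSubfamily i).nonMemberSubfamily j) ≤ (p + m + 2).choose (m + 1))
    (h₁ : (p + m).choose m ≤ #((F.memberSubfamily i).nonMemberSubfamily j))
    (h₂ : (p + m).choose m ≤ #((F.nonMemberSubfamily i).memberSubfamily j)) :
    #F ≤ (p + m + 2).choose (m + 1) + 2 * (p + m + 1).choose (m + 1) := by
  have hV : #((W.erase i).erase j) = p + m + 2 := by
    rw [card_erase_of_mem (mem_erase.2 ⟨hij.symm, hj⟩), card_erase_of_mem hi, hW]; rfl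
  have h := card_add_card_le_of_cross_same_size (by omega) hV
    (nonMemberSubfamily_subset_powersetCard j (memberSubfamily_subset_powersetCard i hF))
    (memberSubfamily_subset_powersetCard j (nonMemberSubfamily_subset_powersetCard i hF))
    (fun S hS T hT => ?_) h₁ h₂
  · have e0 := card_memberSubfamily_add_card_nonMemberSubfamily i F
    have e1 := card_memberSubfamily_add_card_nonMemberSubfamily j (F.memberSubfamily i)
    have e2 := card_memberSubfamily_add_card_nonMemberSubfamily j (F.nonMemberSubfamily i)
    omega
  · simp only [mem_memberSubfamily, mem_nonMemberSubfamily, mem_insert] at hS hT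
    have := hint _ hS.1.1 _ hT.1.1
    rwa [insert_inter_of_notMem (by simpa using hT.1.2), inter_insert_of_notMem hS.2] at this

/-- Double counting in a shifted family: the smallest element of the ground set is contained in
at least the average proportion of members. -/
lemma IsShifted.mul_card_le {s d k : ℕ} (hS : IsShifted s F)
    (hF : F ⊆ (Ico s (s + d)).powersetCard k) : k * #F ≤ d * #{A ∈ F | s ∈ A} := by
  calc k * #F = ∑ A ∈ F, #{x ∈ Ico s (s + d) | x ∈ A} := by
        rw [sum_const_nat (m := k), mul_comm]
        intro A hA
        obtain ⟨h1, h2⟩ := mem_powersetCard.1 (hF hA)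
        rw [filter_mem_eq_inter, inter_eq_right.2 h1, h2]
    _ = ∑ x ∈ Ico s (s + d), #{A ∈ F | x ∈ A} := by
        simp only [card_filter]
        exact sum_comm
    _ ≤ ∑ _x ∈ Ico s (s + d), #{A ∈ F | s ∈ A} :=
        sum_le_sum fun x hx => hS.card_containing_le (mem_Ico.1 hx).1
    _ = d * #{A ∈ F | s ∈ A} := by simp

lemma choose_le_of_mul_le {b c : ℕ} (hb : (p + m + 1).choose (m + 1) ≤ b)
    (h : (m + 3) * b ≤ (p + m + 3) * c) : (p + m).choose m ≤ c := by
  have h1 := Nat.add_one_mul_choose_eq (p + m) m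
  by_contra! hlt
  have h2 : (m + 3) * (p + m + 1) * (p + m).choose m ≤ (m + 1) * (p + m + 3) * c := by
    calc (m + 3) * (p + m + 1) * (p + m).choose m
        = (m + 1) * ((m + 3) * (p + m + 1).choose (m + 1)) := by
          rw [mul_assoc, h1]; ring
      _ ≤ (m + 1) * ((p + m + 3) * c) :=
          Nat.mul_le_mul_left _ ((Nat.mul_le_mul_left _ hb).trans h)
      _ = _ := by ring
  have h3 : (m + 1) * (p + m + 3) ≤ (m + 3) * (p + m + 1) := by nlinarith
  have h4 := Nat.mul_le_mul_right c h3
  have h5 : (m + 3) * (p + m + 1) * c < (m + 3) * (p + m + 1) * (p + m).choose m := by gcongr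
  omega

lemma IsShifted.card_le_of_intersecting (hmp : m + 2 < p) (hS : IsShifted 1 F)
    (hF : F ⊆ (Icc 1 (p + m + 4)).powersetCard (m + 3))
    (hint : ∀ A ∈ F, ∀ B ∈ F, (A ∩ B).Nonempty)
    (hb : (p + m + 1).choose (m + 1) ≤ #(F.nonMemberSubfamily 1)) :
    #F ≤ (p + m + 2).choose (m + 1) + 2 * (p + m + 1).choose (m + 1) := by
  have e1 : (Icc 1 (p + m + 4)).erase 1 = Ico 2 (2 + (p + m + 3)) := by
    ext x; simp only [mem_erase, mem_Icc, mem_Ico]; omega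
  have e2 : ((Icc 1 (p + m + 4)).erase 1).erase 2 = Ico 3 (3 + (p + m + 2)) := by
    ext x; simp only [mem_erase, mem_Icc, mem_Ico]; omega
  have hS' : IsShifted 2 (F.nonMemberSubfamily 1) := by
    intro A hA i j hi hij hiA hjA
    obtain ⟨hA, h1⟩ := mem_nonMemberSubfamily.1 hA
    refine mem_nonMemberSubfamily.2 ⟨hS A hA i j (by omega) hij hiA hjA, ?_⟩
    simp [h1]; omega
  have h₂ : (p + m).choose m ≤ #((F.nonMemberSubfamily 1).memberSubfamily 2) := by
    have h := hS'.mul_card_le (e1 ▸ nonMemberSubfamily_subset_powersetCard 1 hF)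
    have h' : #{A ∈ F.nonMemberSubfamily 1 | 2 ∈ A} =
        #((F.nonMemberSubfamily 1).memberSubfamily 2) := by
      have h3 := card_memberSubfamily_add_card_nonMemberSubfamily 2 (F.nonMemberSubfamily 1)
      have h4 := card_filter_add_card_filter_not (s := F.nonMemberSubfamily 1) (fun A => 2 ∈ A)
      change _ + #{A ∈ F.nonMemberSubfamily 1 | 2 ∉ A} = _ at h3
      omega
    rw [h'] at h
    exact choose_le_of_mul_le hb h
  refine card_le_of_pair (i := 1) (j := 2) hmp (by simp) hF hint (by simp) (by simp) (by simp) ?_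
    (h₂.trans (card_le_card fun A hA => ?_)) h₂
  · set Y := (F.nonMemberSubfamily 1).nonMemberSubfamily 2 with hYdef
    have hY : Y ⊆ (Ico 3 (3 + (p + m + 2))).powersetCard (m + 1 + 2) :=
      e2 ▸ nonMemberSubfamily_subset_powersetCard 2 (nonMemberSubfamily_subset_powersetCard 1 hF)
    have hYS : IsShifted 3 Y := by
      intro A hA i j hi hij hiA hjA
      obtain ⟨hA, h2⟩ := mem_nonMemberSubfamily.1 hA
      refine mem_nonMemberSubfamily.2 ⟨hS' A hA i j (by omega) hij hiA hjA, ?_⟩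
      simp [h2]; omega
    have hYint : ∀ A ∈ Y, ∀ B ∈ Y, 2 + 1 ≤ #(A ∩ B) := by
      intro A hA B hB
      simp only [hYdef, mem_nonMemberSubfamily] at hA hB
      obtain ⟨⟨hA, hA1⟩, hA2⟩ := hA
      obtain ⟨⟨hB, hB1⟩, hB2⟩ := hB
      have hpos : ∀ x ∈ B, 3 ≤ x := fun x hx => by
        have h1 := (mem_Icc.1 ((mem_powersetCard.1 (hF hB)).1 hx)).1
        have h2 : x ≠ 1 := fun h => hB1 (h ▸ hx)
        have h3 : x ≠ 2 := fun h => hB2 (h ▸ hx)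
        omega
      obtain ⟨x, hx⟩ := hint A hA B hB
      obtain ⟨hxA, hxB⟩ := mem_inter.1 hx
      have hx3 := hpos x hxB
      have hA' := hS A hA 1 x le_rfl (by omega) hA1 hxA
      obtain ⟨y, hy⟩ := hint _ hA' B hB
      obtain ⟨hyA, hyB⟩ := mem_inter.1 hy
      have hy3 := hpos y hyB
      have hyA' : y ∈ A.erase x := by
        rcases mem_insert.1 hyA with h | h
        · omega
        · exact h
      have hA'' := hS _ hA' 2 y (by omega) (by omega)
        (by simp [hA2]) hyA
      obtain ⟨z, hz⟩ := hint _ hA'' B hB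
      obtain ⟨hzA, hzB⟩ := mem_inter.1 hz
      have hz3 := hpos z hzB
      simp only [mem_insert, mem_erase] at hzA hyA'
      have hzA' : z ∈ A ∧ z ≠ x ∧ z ≠ y := by
        rcases hzA with h | ⟨h1, h | ⟨h2, h3⟩⟩
        · omega
        · omega
        · exact ⟨h3, h2, h1⟩
      have : #({x, y, z} : Finset ℕ) = 3 :=
        card_eq_three.2 ⟨x, y, z, Ne.symm hyA'.1, Ne.symm hzA'.2.1, Ne.symm hzA'.2.2, rfl⟩
      refine this.ge.trans (card_le_card fun w hw => ?_)
      simp only [mem_insert, mem_singleton] at hw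
      rcases hw with rfl | rfl | rfl
      · exact hx
      · exact mem_inter.2 ⟨hyA'.2, hyB⟩
      · exact mem_inter.2 ⟨hzA'.1, hzB⟩
    have hD := hYS.card_le_card_disjoint _ hY (by omega) hYint
    have hX : (F.memberSubfamily 1).memberSubfamily 2 ⊆
        (Ico 3 (3 + (p + m + 2))).powersetCard (m + 1) :=
      e2 ▸ memberSubfamily_subset_powersetCard 2 (memberSubfamily_subset_powersetCard 1 hF)
    have hdisj : Disjoint ((F.memberSubfamily 1).memberSubfamily 2)
        {G ∈ (Ico 3 (3 + (p + m + 2))).powersetCard (m + 1) | ∃ T ∈ Y, Disjoint G T} := by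
      rw [disjoint_left]
      rintro G hG hG'
      obtain ⟨-, T, hT, hGT⟩ := mem_filter.1 hG'
      simp only [hYdef, mem_memberSubfamily, mem_nonMemberSubfamily] at hG hT
      have := hint _ hG.1.1 T hT.1.1
      rw [insert_inter_of_notMem hT.1.2, insert_inter_of_notMem hT.2,
        disjoint_iff_inter_eq_empty.1 hGT] at this
      simp at this
    have := card_le_card (union_subset hX (filter_subset (fun G => ∃ T ∈ Y, Disjoint G T) _))
    rw [card_union_of_disjoint hdisj, card_powersetCard, Nat.card_Ico, Nat.add_sub_cancel_left]
      at this
    omega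
  · simp only [mem_memberSubfamily, mem_nonMemberSubfamily, mem_insert, not_or] at hA ⊢
    have h := hS _ hA.1.1 1 2 le_rfl (by omega) (by simpa using hA.1.2) (mem_insert_self _ _)
    rw [erase_insert hA.2] at h
    exact ⟨⟨h, hA.1.2.2⟩, hA.2⟩

lemma card_le_of_le_card_nonMemberSubfamily (hmp : m + 2 < p)
    (hF : F ⊆ (Icc 1 (p + m + 4)).powersetCard (m + 3))
    (hint : ∀ A ∈ F, ∀ B ∈ F, (A ∩ B).Nonempty)
    (hc : ∀ i ∈ Icc 1 (p + m + 4), (p + m).choose m ≤ #(F.nonMemberSubfamily i)) :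
    #F ≤ (p + m + 2).choose (m + 1) + 2 * (p + m + 1).choose (m + 1) := by
  have hW : #(Icc 1 (p + m + 4)) = p + m + 4 := by simp
  have star : ∀ F ⊆ (Icc 1 (p + m + 4)).powersetCard (m + 3),
      (∀ A ∈ F, ∀ B ∈ F, (A ∩ B).Nonempty) → ∀ i ∈ Icc 1 (p + m + 4),
      (p + m).choose m ≤ #(F.nonMemberSubfamily i) →
      #(F.nonMemberSubfamily i) ≤ (p + m + 1).choose (m + 1) →
      #F ≤ (p + m + 2).choose (m + 1) + 2 * (p + m + 1).choose (m + 1) := by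
    intro F hF hint i hi hle hge
    have h := card_le_of_card_nonMemberSubfamily_le (y := ((p + m : ℕ) : ℝ)) hmp hW hF hint hi
      (by exact_mod_cast Nat.le_add_right _ _) (by push_cast; exact le_rfl)
      (by rw [genChoose_natCast, Nat.choose_symm_add]; exact_mod_cast hle)
      (by rw [add_assoc, Nat.choose_symm_add]; exact hge)
    rw [choose_sub_choose_sub_choose] at h
    exact_mod_cast h
  induction F using shift_induction 1 with
  | base F hS =>
    rcases le_total #(F.nonMemberSubfamily 1) ((p + m + 1).choose (m + 1)) with h | h
    · exact star F hF hint 1 (by simp) (hc 1 (by simp)) h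
    · exact hS.card_le_of_intersecting hmp hF hint h
  | step F i j hi hij hj ih =>
    obtain ⟨A, hA, hjA⟩ := hj
    have hjW := (mem_powersetCard.1 (hF hA)).1 hjA
    have hiW : i ∈ Icc 1 (p + m + 4) := by rw [mem_Icc] at hjW ⊢; omega
    by_cases hlow : ∃ x ∈ Icc 1 (p + m + 4),
        #(F.nonMemberSubfamily x) ≤ (p + m + 1).choose (m + 1)
    · obtain ⟨x, hx, hlow⟩ := hlow
      exact star F hF hint x hx (hc x hx) hlow
    push Not at hlow
    by_cases hc' : ∀ x ∈ Icc 1 (p + m + 4),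
        (p + m).choose m ≤ #((𝓒 {i} {j} F).nonMemberSubfamily x)
    · have := ih (subset_of_mem_shift hij.ne hiW hF) (intersecting_shift hij.ne hint) hc'
      rwa [UV.card_compression] at this
    push Not at hc'
    obtain ⟨x, hx, hlt⟩ := hc'
    obtain rfl : x = i := by
      by_contra h
      exact absurd ((hc x hx).trans (card_avoiding_le_card_avoiding_shift F hij.ne h))
        (not_le.2 hlt)
    have e0 : #((F.nonMemberSubfamily x).nonMemberSubfamily j) ≤
        #((𝓒 {x} {j} F).nonMemberSubfamily x) := by
      refine le_trans (le_of_eq ?_) (card_avoiding_pair_le_card_avoiding_shift F)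
      simp only [nonMemberSubfamily, filter_filter]
    have hV : #(((Icc 1 (p + m + 4)).erase x).erase j) = p + m + 2 := by
      rw [card_erase_of_mem (mem_erase.2 ⟨hij.ne', hjW⟩), card_erase_of_mem hiW, hW]; rfl
    have hch : (p + m).choose m ≤ (p + m).choose (m + 1) :=
      Nat.choose_le_succ_of_lt_half_left (by omega)
    have hpascal : (p + m + 1).choose (m + 1) = (p + m).choose m + (p + m).choose (m + 1) :=
      Nat.choose_succ_succ _ _
    have hi' := hlow x hiW
    have hj' := hlow j hjW
    have c1 := card_memberSubfamily_add_card_nonMemberSubfamily j (F.nonMemberSubfamily x)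
    have c2 := card_memberSubfamily_add_card_nonMemberSubfamily x (F.nonMemberSubfamily j)
    have c3 : (F.nonMemberSubfamily j).nonMemberSubfamily x =
        (F.nonMemberSubfamily x).nonMemberSubfamily j := by
      ext A
      simp only [mem_nonMemberSubfamily]
      tauto
    rw [c3, memberSubfamily_nonMemberSubfamily_comm hij.ne] at c2
    refine card_le_of_pair hmp hW hF hint hiW hjW hij.ne ?_ (by omega) (by omega)
    refine card_add_card_le_of_cross_of_small (by omega) hV
      (memberSubfamily_subset_powersetCard j (memberSubfamily_subset_powersetCard x hF))
      (nonMemberSubfamily_subset_powersetCard j (nonMemberSubfamily_subset_powersetCard x hF))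
      (fun S hS T hT => ?_) (by omega)
    simp only [mem_memberSubfamily, mem_nonMemberSubfamily] at hS hT
    have := hint _ hS.1.1 T hT.1.1
    rwa [insert_inter_of_notMem hT.1.2, insert_inter_of_notMem hT.2] at this

end Intersecting

/-- **Frankl's theorem** (real-parameter version): let `n > 2k > 0` and let
`F ⊆ C([n],k)` be intersecting. If `γ(F) ≥ C(n-u-1, n-k-1)` for some real
`3 ≤ u ≤ k`, then `|F| ≤ C(n-1, k-1) + C(n-u-1, n-k-1) - C(n-u-1, k-1)`. -/
theorem frankl_diversity (n k : ℕ) (hk : 0 < k) (hnk : 2 * k < n)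
    (F : Finset (Finset ℕ))
    (hF : F ⊆ (Finset.Icc 1 n).powersetCard k)
    (hint : ∀ A ∈ F, ∀ B ∈ F, (A ∩ B).Nonempty)
    (u : ℝ) (hu : 3 ≤ u) (huk : u ≤ (k : ℝ))
    (hdiv : genChoose ((n : ℝ) - u - 1) (n - k - 1) ≤ (diversity n F : ℝ)) :
    (F.card : ℝ) ≤ ((n - 1).choose (k - 1) : ℝ)
      + genChoose ((n : ℝ) - u - 1) (n - k - 1)
      - genChoose ((n : ℝ) - u - 1) (k - 1) := by
  have hk3 : 3 ≤ k := by exact_mod_cast hu.trans huk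
  obtain ⟨m, rfl⟩ : ∃ m, k = m + 3 := ⟨k - 3, by omega⟩
  obtain ⟨p, rfl⟩ : ∃ p, n = p + m + 4 := ⟨n - m - 4, by omega⟩
  have hmp : m + 2 < p := by omega
  have hcard : ∀ x, #F - #{A ∈ F | x ∈ A} = #(F.nonMemberSubfamily x) := fun x => by
    have := card_filter_add_card_filter_not (s := F) (fun A => x ∈ A)
    change _ + #(F.nonMemberSubfamily x) = _ at this
    omega
  have hge : ∀ x ∈ Icc 1 (p + m + 4), diversity (p + m + 4) F ≤ #(F.nonMemberSubfamily x) := by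
    intro x hx
    rw [← hcard]
    exact Nat.sub_le_sub_left (le_sup (f := fun i => #{A ∈ F | i ∈ A}) hx) _
  obtain ⟨i, hi, hmax⟩ := exists_mem_eq_sup (Icc 1 (p + m + 4)) ⟨1, by simp⟩
    (fun i => #{A ∈ F | i ∈ A})
  have hdi : diversity (p + m + 4) F = #(F.nonMemberSubfamily i) := by
    rw [← hcard, diversity, maxDegree, hmax]
  rw [show p + m + 4 - (m + 3) - 1 = p by omega] at hdiv ⊢
  rw [show p + m + 4 - 1 = p + m + 3 by omega, show m + 3 - 1 = m + 2 by omega]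
  push_cast at hdiv huk ⊢
  set y : ℝ := (p : ℝ) + m + 4 - u - 1 with hy
  have hpy : (p : ℝ) ≤ y := by linarith
  have hyp : y ≤ p + m := by linarith
  rcases le_total #(F.nonMemberSubfamily i) ((p + m + 1).choose p) with h | h
  · have := card_le_of_card_nonMemberSubfamily_le hmp (by simp) hF hint hi hpy hyp
      (by rwa [← hdi]) h
    linarith
  · have hle : (p + m).choose m ≤ (p + m + 1).choose p := by
      rw [add_assoc, Nat.choose_symm_add, ← add_assoc, Nat.choose_succ_succ]
      exact Nat.le_add_right _ _
    have h1 := card_le_of_le_card_nonMemberSubfamily hmp hF hint fun x hx =>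
      hle.trans (h.trans (hdi ▸ hge x hx))
    have h2 : (#F : ℝ) ≤ _ := Nat.cast_le.2 h1
    rw [← choose_sub_choose_sub_choose] at h2
    have h3 := genChoose_sub_mono (q := m + 2) (by omega) hmp hpy (by push_cast; linarith)
      (show y ≤ ((p + m : ℕ) : ℝ) by push_cast; exact hyp) (by push_cast; linarith)
    linarith
end
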